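/- arXiv:1607.03503 — 2 statements merged into one kernel-verified Lean document; each statement's English description precedes it below -/
import Mathlib

section
/- Let N be a complete normal subgroup of an n-space group Γ, let T be the group of translations of Γ, let W = Span(Z(N)), let L = {u ∈ Eⁿ : u + I ∈ Z(N)}, let 𝒦 = W/L, and let κ : W → 𝒦 be the quotient map of (Γ/N)-modules. Then the cokernel of the homomorphism κ_* : Hom_{Γ/N}(TN/N, W) → Hom_{Γ/N}(TN/N, 𝒦) given by post-composition with κ is finite; that is, the image of κ_* has finite index in Hom_{Γ/N}(TN/N, 𝒦). -/
noncomputable section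

/-- The translation `x ↦ a + x` of a normed additive group, as an isometry. -/
def transIso {X : Type*} [SeminormedAddCommGroup X] (a : X) : X ≃ᵢ X :=
  IsometryEquiv.constVAdd a

@[simp] lemma transIso_apply {X : Type*} [SeminormedAddCommGroup X] (a x : X) :
    transIso a x = a + x := rfl

/-- `parts φ a A` means that the isometry `φ` is `a + A`, i.e. `φ x = a + A x` for all `x`. -/
def parts {X : Type*} [NormedAddCommGroup X] [InnerProductSpace ℝ X]
    (φ : X ≃ᵢ X) (a : X) (A : X ≃ₗᵢ[ℝ] X) : Prop :=
  ∀ x, φ x = a + A x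

/-- The span of a group of isometries: the real span of the set of translation vectors of
the translations belonging to the group. -/
def spanOf {X : Type*} [NormedAddCommGroup X] [InnerProductSpace ℝ X]
    (H : Subgroup (X ≃ᵢ X)) : Submodule ℝ X :=
  Submodule.span ℝ {a : X | transIso a ∈ H}

/-- A space group: a group of isometries acting discontinuously (the discreteness condition)
with compact quotient (expressed by a compact set meeting every orbit). -/
def IsSpaceGroup {X : Type*} [MetricSpace X] (Γ : Subgroup (X ≃ᵢ X)) : Prop :=
  (∀ K : Set X, IsCompact K →
    {γ : X ≃ᵢ X | γ ∈ Γ ∧ ((γ : X → X) '' K ∩ K).Nonempty}.Finite) ∧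
  ∃ K : Set X, IsCompact K ∧ ∀ x : X, ∃ γ ∈ Γ, (γ : X → X) x ∈ K

/-- `N` is a complete normal subgroup of `Γ`: it is normal in `Γ` and consists exactly of
those `a + A ∈ Γ` with `a ∈ Span N` and `A` fixing `(Span N)ᗮ` pointwise. -/
def IsCompleteNormal {X : Type*} [NormedAddCommGroup X] [InnerProductSpace ℝ X]
    (Γ N : Subgroup (X ≃ᵢ X)) : Prop :=
  N ≤ Γ ∧ (∀ γ ∈ Γ, ∀ ν ∈ N, γ * ν * γ⁻¹ ∈ N) ∧
  ∀ φ ∈ Γ, ∀ (a : X) (A : X ≃ₗᵢ[ℝ] X), parts φ a A →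
    (φ ∈ N ↔ a ∈ spanOf N ∧ ∀ w ∈ (spanOf N)ᗮ, A w = w)

/-- The real span of the set of translation vectors of the central translations of `N`,
i.e. `Span(Z(N))`. -/
def centerSpan {X : Type*} [NormedAddCommGroup X] [InnerProductSpace ℝ X]
    (N : Subgroup (X ≃ᵢ X)) : Submodule ℝ X :=
  Submodule.span ℝ
    {u : X | ∃ h : transIso u ∈ N, (⟨transIso u, h⟩ : N) ∈ Subgroup.center N}


/-- The subgroup of all translations of a normed additive group. -/
def transSubgroup (X : Type*) [NormedAddCommGroup X] : Subgroup (X ≃ᵢ X) where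
  carrier := {g | ∃ a : X, g = transIso a}
  mul_mem' := by
    rintro g h ⟨a, rfl⟩ ⟨b, rfl⟩
    exact ⟨a + b, by ext x; exact (add_assoc a b x).symm⟩
  one_mem' := ⟨0, by ext x; exact (zero_add x).symm⟩
  inv_mem' := by
    rintro g ⟨a, rfl⟩
    exact ⟨-a, (eq_inv_of_mul_eq_one_left (by ext x; exact neg_add_cancel_left a x)).symm⟩

/-- The lattice `L = {u : u + I ∈ Z(N)}` of translation vectors of central translations
of `N`. -/
def Lset {X : Type*} [NormedAddCommGroup X] [InnerProductSpace ℝ X]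
    (N : Subgroup (X ≃ᵢ X)) : Set X :=
  {u : X | ∃ h : transIso u ∈ N, (⟨transIso u, h⟩ : N) ∈ Subgroup.center N}

/-- The subgroup `TN` of `Γ` generated by the group `T = Γ ⊓ transSubgroup` of
translations of `Γ` and the normal subgroup `N` (equal to the set product `TN`). -/
abbrev TNsub {n : ℕ}
    (Γ N : Subgroup (EuclideanSpace ℝ (Fin n) ≃ᵢ EuclideanSpace ℝ (Fin n))) :
    Subgroup (EuclideanSpace ℝ (Fin n) ≃ᵢ EuclideanSpace ℝ (Fin n)) :=
  (Γ ⊓ transSubgroup (EuclideanSpace ℝ (Fin n))) ⊔ N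

/-- `IsEquivariantHomModL Γ N ψ` says that `ψ`, defined on the subgroup `TN` of `Γ`
with values in `W = Span(Z(N))`, represents a `(Γ/N)`-module homomorphism
`TN/N → 𝒦 = W/L`. -/
def IsEquivariantHomModL {n : ℕ}
    (Γ N : Subgroup (EuclideanSpace ℝ (Fin n) ≃ᵢ EuclideanSpace ℝ (Fin n)))
    (ψ : ↥(TNsub Γ N) → EuclideanSpace ℝ (Fin n)) : Prop :=
  (∀ x, ψ x ∈ centerSpan N) ∧
  (∀ x y : ↥(TNsub Γ N), ψ (x * y) - ψ x - ψ y ∈ Lset N) ∧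
  (∀ ν x : ↥(TNsub Γ N),
    (ν : EuclideanSpace ℝ (Fin n) ≃ᵢ EuclideanSpace ℝ (Fin n)) ∈ N →
    ψ (ν * x) - ψ x ∈ Lset N) ∧
  (∀ γ ∈ Γ, ∀ (b : EuclideanSpace ℝ (Fin n))
    (B : EuclideanSpace ℝ (Fin n) ≃ₗᵢ[ℝ] EuclideanSpace ℝ (Fin n)),
    parts γ b B → ∀ x y : ↥(TNsub Γ N),
      γ * (x : EuclideanSpace ℝ (Fin n) ≃ᵢ EuclideanSpace ℝ (Fin n)) * γ⁻¹ =
        (y : EuclideanSpace ℝ (Fin n) ≃ᵢ EuclideanSpace ℝ (Fin n)) →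
      ψ y - B (ψ x) ∈ Lset N)

/-- `IsEquivariantHomToW Γ N Ψ` says that `Ψ` defines a `(Γ/N)`-module homomorphism
`TN/N → W = Span(Z(N))`. -/
def IsEquivariantHomToW {n : ℕ}
    (Γ N : Subgroup (EuclideanSpace ℝ (Fin n) ≃ᵢ EuclideanSpace ℝ (Fin n)))
    (Ψ : ↥(TNsub Γ N) → EuclideanSpace ℝ (Fin n)) : Prop :=
  (∀ x, Ψ x ∈ centerSpan N) ∧
  (∀ x y : ↥(TNsub Γ N), Ψ (x * y) = Ψ x + Ψ y) ∧
  (∀ ν x : ↥(TNsub Γ N),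
    (ν : EuclideanSpace ℝ (Fin n) ≃ᵢ EuclideanSpace ℝ (Fin n)) ∈ N →
    Ψ (ν * x) = Ψ x) ∧
  (∀ γ ∈ Γ, ∀ (b : EuclideanSpace ℝ (Fin n))
    (B : EuclideanSpace ℝ (Fin n) ≃ₗᵢ[ℝ] EuclideanSpace ℝ (Fin n)),
    parts γ b B → ∀ x y : ↥(TNsub Γ N),
      γ * (x : EuclideanSpace ℝ (Fin n) ≃ᵢ EuclideanSpace ℝ (Fin n)) * γ⁻¹ =
        (y : EuclideanSpace ℝ (Fin n) ≃ᵢ EuclideanSpace ℝ (Fin n)) →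
      Ψ y = B (Ψ x))


/-- A map that is additive modulo `L` lifts to an additive map on a finitely generated abelian
group, killing a given subgroup with torsion-free quotient. -/
lemma exists_addMonoidHom_lift {A V : Type*} [AddCommGroup A] [AddCommGroup V]
    [Module.Finite ℤ A] (M : AddSubgroup A) (L : AddSubgroup V)
    (htf : ∀ (k : ℤ) (a : A), k ≠ 0 → k • a ∈ M → a ∈ M) (f : A → V)
    (hadd : ∀ a b, f (a + b) - f a - f b ∈ L) (hM : ∀ a ∈ M, f a ∈ L) :
    ∃ F : A →+ V, (∀ a ∈ M, F a = 0) ∧ ∀ a, f a - F a ∈ L := by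
  let g : A →+ V ⧸ L := AddMonoidHom.mk' (fun a => (QuotientAddGroup.mk (f a) : V ⧸ L)) (by
    intro a b
    rw [← QuotientAddGroup.mk_add, ← sub_eq_zero, ← QuotientAddGroup.mk_sub,
      QuotientAddGroup.eq_zero_iff, ← sub_sub]
    exact hadd a b)
  have hg : M ≤ g.ker := fun a ha => (QuotientAddGroup.eq_zero_iff _).2 (hM a ha)
  have : IsAddTorsionFree (A ⧸ M) := by
    rw [← Module.isTorsionFree_int_iff_isAddTorsionFree]
    refine Module.isTorsionFree_iff_smul_eq_zero.2 ?_
    intro k q hq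
    induction q using QuotientAddGroup.induction_on with
    | H a =>
      by_cases hk : k = 0
      · exact Or.inl hk
      · right
        rw [← QuotientAddGroup.mk_zsmul, QuotientAddGroup.eq_zero_iff] at hq
        exact (QuotientAddGroup.eq_zero_iff _).2 (htf k a hk hq)
  have : Module.Finite ℤ (A ⧸ M) :=
    Module.Finite.of_surjective (QuotientAddGroup.mk' M).toIntLinearMap
      (QuotientAddGroup.mk'_surjective M)
  have : Module.Free ℤ (A ⧸ M) := inferInstance
  obtain ⟨h, hh⟩ := Module.projective_lifting_property (QuotientAddGroup.mk' L).toIntLinearMap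
    (QuotientAddGroup.lift M g hg).toIntLinearMap (QuotientAddGroup.mk'_surjective L)
  refine ⟨h.toAddMonoidHom.comp (QuotientAddGroup.mk' M), fun a ha => ?_, fun a => ?_⟩
  · have : (QuotientAddGroup.mk' M) a = 0 := (QuotientAddGroup.eq_zero_iff _).2 ha
    rw [AddMonoidHom.comp_apply, this, map_zero]
  · have := LinearMap.congr_fun hh (QuotientAddGroup.mk a)
    rw [← QuotientAddGroup.eq_zero_iff, QuotientAddGroup.mk_sub, sub_eq_zero]
    exact this.symm

/-- A map that is additive and equivariant modulo `L` differs, up to a uniform integer multiple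
and modulo `L`, from an equivariant additive map obtained by averaging over a finite quotient. -/
lemma exists_equivariant_approx {G A E : Type*} [Group G] [AddCommGroup A] [AddCommGroup E]
    [Module ℝ E] [Module.Finite ℤ A] (σ : G →* AddMonoid.End A) (ρ : G →* Module.End ℝ E)
    (M : AddSubgroup A) (L : AddSubgroup E) (W : Submodule ℝ E)
    (hσM : ∀ g, ∀ a ∈ M, σ g a ∈ M) (hρL : ∀ g, ∀ u ∈ L, ρ g u ∈ L)
    (hρW : ∀ g, ∀ u ∈ W, ρ g u ∈ W)
    (K : Subgroup G) [K.FiniteIndex] (hσK : ∀ k ∈ K, ∀ a, σ k a = a)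
    (hρK : ∀ k ∈ K, ∀ w ∈ W, ρ k w = w)
    (htf : ∀ (k : ℤ) (a : A), k ≠ 0 → k • a ∈ M → a ∈ M) (f : A → E) (hW : ∀ a, f a ∈ W)
    (hadd : ∀ a b, f (a + b) - f a - f b ∈ L) (hM : ∀ a ∈ M, f a ∈ L)
    (hequiv : ∀ g a, f (σ g a) - ρ g (f a) ∈ L) :
    ∃ F : A →+ E, (∀ a, F a ∈ W) ∧ (∀ a ∈ M, F a = 0) ∧ (∀ g a, F (σ g a) = ρ g (F a)) ∧
      ∀ a, K.index • (f a - F a) ∈ L := by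
  obtain ⟨F₀, hF₀M, hF₀⟩ := exists_addMonoidHom_lift M (L.addSubgroupOf W.toAddSubgroup) htf
    (fun a => (⟨f a, hW a⟩ : W.toAddSubgroup)) (fun a b => hadd a b) (fun a ha => hM a ha)
  replace hF₀ : ∀ a, f a - F₀ a ∈ L := hF₀
  have hF₀W : ∀ a, (F₀ a : E) ∈ W := fun a => (F₀ a).2
  have : Fintype (G ⧸ K) := Fintype.ofFinite _
  have hσ : ∀ g h a, σ (g * h) a = σ g (σ h a) := fun g h a => by rw [map_mul]; rfl
  have hρ : ∀ g h u, ρ (g * h) u = ρ g (ρ h u) := fun g h a => by rw [map_mul]; rfl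
  let H : G → A →+ E := fun g =>
    (ρ g).toAddMonoidHom.comp (W.toAddSubgroup.subtype.comp (F₀.comp (σ g⁻¹)))
  have hH : ∀ g a, H g a = ρ g (F₀ (σ g⁻¹ a)) := fun g a => rfl
  have hHK : ∀ g, ∀ k ∈ K, H (g * k) = H g := by
    intro g k hk
    ext a
    rw [hH, hH, hρ, hρK k hk _ (hF₀W _), mul_inv_rev, hσ, hσK _ (inv_mem hk)]
  have hm : K.index = Fintype.card (G ⧸ K) := by
    rw [Subgroup.index, Nat.card_eq_fintype_card]
  have hm0 : (K.index : ℝ) ≠ 0 := by exact_mod_cast Subgroup.FiniteIndex.index_ne_zero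
  refine ⟨(LinearMap.toAddMonoidHom ((K.index : ℝ)⁻¹ • (LinearMap.id : E →ₗ[ℝ] E))).comp
    (∑ q : G ⧸ K, H q.out), ?_, ?_, ?_, ?_⟩
  · intro a
    simp only [AddMonoidHom.comp_apply, AddMonoidHom.finsetSum_apply]
    exact W.smul_mem _ (W.sum_mem fun q _ => hρW _ _ (hF₀W _))
  · intro a ha
    have : ∀ g, H g a = 0 := fun g => by rw [hH, hF₀M _ (hσM _ _ ha)]; simp
    simp [this]
  · intro g a
    simp only [AddMonoidHom.comp_apply, AddMonoidHom.finsetSum_apply]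
    have h1 : ∀ h, H h (σ g a) = ρ g (H (g⁻¹ * h) a) := by
      intro h
      rw [hH, hH, ← hρ, mul_inv_cancel_left, mul_inv_rev, inv_inv, hσ]
    have h2 : ∀ q : G ⧸ K, H (g⁻¹ * q.out) = H (g⁻¹ • q).out := by
      intro q
      obtain ⟨k, hk⟩ := QuotientGroup.mk_out_eq_mul K (g⁻¹ * q.out)
      have : ((g⁻¹ * q.out : G) : G ⧸ K) = g⁻¹ • q := by
        conv_rhs => rw [← QuotientGroup.out_eq' q]
        rfl
      rw [← this, hk, hHK _ _ k.2]
    simp only [h1, h2]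
    rw [← map_sum, Fintype.sum_equiv (MulAction.toPerm g⁻¹ : Equiv.Perm (G ⧸ K))
      (fun q => H (g⁻¹ • q).out a) (fun q => H q.out a) (fun q => rfl)]
    simp
  · intro a
    have h1 : K.index • (f a - (LinearMap.toAddMonoidHom ((K.index : ℝ)⁻¹ •
        (LinearMap.id : E →ₗ[ℝ] E))).comp (∑ q : G ⧸ K, H q.out) a) =
        ∑ q : G ⧸ K, (f a - H q.out a) := by
      rw [Finset.sum_sub_distrib, Finset.sum_const, Finset.card_univ, ← hm, smul_sub]
      congr 1
      rw [← Nat.cast_smul_eq_nsmul ℝ]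
      simp [hm0]
    rw [h1]
    refine L.sum_mem fun q _ => ?_
    generalize q.out = g
    have h2 := L.add_mem (hequiv g (σ g⁻¹ a)) (hρL g _ (hF₀ (σ g⁻¹ a)))
    rw [← hσ, mul_inv_cancel, map_one, map_sub] at h2
    rw [hH]
    convert h2 using 1
    simp

/-- The quotient of a finitely generated abelian group by its `m`-multiples is finite. -/
lemma finite_quotient_range_zsmul (A : Type*) [AddCommGroup A] [Module.Finite ℤ A]
    (m : ℤ) (hm : m ≠ 0) : Finite (A ⧸ (zsmulAddGroupHom m : A →+ A).range) := by
  have : Module.Finite ℤ (A ⧸ (zsmulAddGroupHom m : A →+ A).range) :=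
    Module.Finite.of_surjective (QuotientAddGroup.mk' _).toIntLinearMap
      (QuotientAddGroup.mk'_surjective _)
  refine Module.finite_of_fg_torsion _ ?_
  intro q
  induction q using QuotientAddGroup.induction_on with
  | H a =>
    exact ⟨⟨m, mem_nonZeroDivisors_of_ne_zero hm⟩,
      (QuotientAddGroup.eq_zero_iff (m • a)).2 ⟨a, rfl⟩⟩

section Translations

variable {X : Type*} [NormedAddCommGroup X]

lemma transIso_add (a b : X) : transIso (a + b) = transIso a * transIso b := by
  ext x; exact add_assoc a b x

lemma transIso_zero : transIso (0 : X) = 1 := by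
  ext x; exact zero_add x

lemma transIso_neg (a : X) : transIso (-a) = (transIso a)⁻¹ :=
  eq_inv_of_mul_eq_one_left (by rw [← transIso_add, neg_add_cancel, transIso_zero])

lemma transIso_injective : Function.Injective (transIso : X → X ≃ᵢ X) := fun a b h => by
  simpa using congrArg (fun φ : X ≃ᵢ X => φ 0) h

/-- The additive group of translation vectors of the translations in a group of isometries. -/
def transVec (H : Subgroup (X ≃ᵢ X)) : AddSubgroup X where
  carrier := {a | transIso a ∈ H}
  add_mem' := fun {a b} ha hb => by
    rw [Set.mem_ofPred_eq, transIso_add]; exact H.mul_mem ha hb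
  zero_mem' := by rw [Set.mem_ofPred_eq, transIso_zero]; exact H.one_mem
  neg_mem' := fun {a} ha => by
    rw [Set.mem_ofPred_eq, transIso_neg]; exact H.inv_mem ha

lemma mem_transVec {H : Subgroup (X ≃ᵢ X)} {a : X} : a ∈ transVec H ↔ transIso a ∈ H := Iff.rfl

end Translations

section Isometries

variable {X : Type*} [NormedAddCommGroup X] [InnerProductSpace ℝ X]

/-- The linear part of an isometry of a real inner product space, as a monoid homomorphism. -/
def linPart : (X ≃ᵢ X) →* Module.End ℝ X where
  toFun γ := γ.toRealLinearIsometryEquiv.toLinearEquiv.toLinearMap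
  map_one' := by ext x; simp
  map_mul' γ δ := by
    ext x
    have h := map_sub γ.toRealLinearIsometryEquiv (δ x) (δ 0)
    simp only [IsometryEquiv.toRealLinearIsometryEquiv_apply] at h
    simp [IsometryEquiv.mul_apply, h]

lemma linPart_apply (γ : X ≃ᵢ X) (x : X) : linPart γ x = γ x - γ 0 := by
  simp [linPart]

lemma norm_linPart (γ : X ≃ᵢ X) (x : X) : ‖linPart γ x‖ = ‖x‖ :=
  γ.toRealLinearIsometryEquiv.norm_map x

lemma linPart_eq_of_parts {γ : X ≃ᵢ X} {b : X} {B : X ≃ₗᵢ[ℝ] X} (h : parts γ b B) (x : X) :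
    linPart γ x = B x := by
  simp [linPart_apply, h x, h 0]

lemma mul_transIso (γ : X ≃ᵢ X) (a : X) : γ * transIso a = transIso (linPart γ a) * γ := by
  ext x
  have h := map_add (linPart γ) a x
  rw [linPart_apply γ x, linPart_apply γ (a + x), sub_eq_iff_eq_add] at h
  simp only [IsometryEquiv.mul_apply, transIso_apply, h]
  abel

lemma conj_transIso (γ : X ≃ᵢ X) (a : X) :
    γ * transIso a * γ⁻¹ = transIso (linPart γ a) := by
  rw [mul_transIso, mul_inv_cancel_right]

lemma linPart_mem_transVec {Γ H : Subgroup (X ≃ᵢ X)}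
    (hH : ∀ γ ∈ Γ, ∀ ν ∈ H, γ * ν * γ⁻¹ ∈ H) {γ : X ≃ᵢ X} (hγ : γ ∈ Γ) {a : X}
    (ha : a ∈ transVec H) : linPart γ a ∈ transVec H := by
  rw [mem_transVec, ← conj_transIso]
  exact hH γ hγ _ ha

lemma mem_Lset_iff {N : Subgroup (X ≃ᵢ X)} {u : X} :
    u ∈ Lset N ↔ u ∈ transVec N ∧ ∀ ν ∈ N, linPart ν u = u := by
  have key : ∀ ν : X ≃ᵢ X, ν * transIso u = transIso u * ν ↔ linPart ν u = u := fun ν => by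
    rw [mul_transIso, mul_left_inj, transIso_injective.eq_iff]
  constructor
  · rintro ⟨h, hc⟩
    refine ⟨h, fun ν hν => (key ν).1 ?_⟩
    exact congrArg Subtype.val (Subgroup.mem_center_iff.1 hc ⟨ν, hν⟩)
  · rintro ⟨h, hc⟩
    refine ⟨h, Subgroup.mem_center_iff.2 fun ν => Subtype.ext ?_⟩
    exact (key ν).2 (hc ν ν.2)

/-- The lattice of translation vectors of the central translations, as an additive subgroup. -/
def centerLattice (N : Subgroup (X ≃ᵢ X)) : AddSubgroup X where
  carrier := Lset N
  add_mem' := fun {a b} ha hb => by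
    rw [mem_Lset_iff] at *
    exact ⟨add_mem ha.1 hb.1, fun ν hν => by rw [map_add, ha.2 ν hν, hb.2 ν hν]⟩
  zero_mem' := mem_Lset_iff.2 ⟨zero_mem _, fun ν _ => map_zero _⟩
  neg_mem' := fun {a} ha => by
    rw [mem_Lset_iff] at *
    exact ⟨neg_mem ha.1, fun ν hν => by rw [map_neg, ha.2 ν hν]⟩

lemma mem_centerLattice {N : Subgroup (X ≃ᵢ X)} {u : X} : u ∈ centerLattice N ↔ u ∈ Lset N :=
  Iff.rfl

lemma linPart_mul_apply (γ δ : X ≃ᵢ X) (u : X) :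
    linPart (γ * δ) u = linPart γ (linPart δ u) := by
  rw [map_mul]; rfl

lemma linPart_mem_centerLattice {Γ N : Subgroup (X ≃ᵢ X)}
    (hN : ∀ γ ∈ Γ, ∀ ν ∈ N, γ * ν * γ⁻¹ ∈ N) {γ : X ≃ᵢ X} (hγ : γ ∈ Γ) {u : X}
    (hu : u ∈ centerLattice N) : linPart γ u ∈ centerLattice N := by
  rw [mem_centerLattice, mem_Lset_iff] at *
  refine ⟨linPart_mem_transVec hN hγ hu.1, fun ν hν => ?_⟩
  have h := hu.2 _ (hN γ⁻¹ (Γ.inv_mem hγ) ν hν)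
  rw [inv_inv] at h
  conv_rhs => rw [← h]
  simp only [← linPart_mul_apply]
  congr 2
  group

lemma linPart_mem_centerSpan {Γ N : Subgroup (X ≃ᵢ X)}
    (hN : ∀ γ ∈ Γ, ∀ ν ∈ N, γ * ν * γ⁻¹ ∈ N) {γ : X ≃ᵢ X} (hγ : γ ∈ Γ) {u : X}
    (hu : u ∈ centerSpan N) : linPart γ u ∈ centerSpan N := by
  have : centerSpan N ≤ (centerSpan N).comap (linPart γ) :=
    Submodule.span_le.2 fun v hv => Submodule.subset_span
      (linPart_mem_centerLattice hN hγ (show v ∈ centerLattice N from hv))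
  exact this hu

lemma linPart_eq_of_mem_centerSpan {Γ N : Subgroup (X ≃ᵢ X)} (hNΓ : N ≤ Γ) {γ : X ≃ᵢ X}
    (hγ : ∀ a ∈ transVec Γ, linPart γ a = a) {u : X} (hu : u ∈ centerSpan N) :
    linPart γ u = u := by
  have : centerSpan N ≤ LinearMap.eqLocus (linPart γ) LinearMap.id :=
    Submodule.span_le.2 fun v hv => hγ v (hNΓ (mem_Lset_iff.1 hv).1)
  exact this hu

/-- Conjugation on the translations of `Γ`, written additively. -/
def linPartTransVec (Γ : Subgroup (X ≃ᵢ X)) : Γ →* AddMonoid.End (transVec Γ) where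
  toFun γ := ((linPart (γ : X ≃ᵢ X)).toAddMonoidHom.comp (transVec Γ).subtype).codRestrict
    (transVec Γ) fun a => linPart_mem_transVec
      (fun γ hγ ν hν => Γ.mul_mem (Γ.mul_mem hγ hν) (Γ.inv_mem hγ)) γ.2 a.2
  map_one' := AddMonoidHom.ext fun a => Subtype.ext (by
    change linPart (1 : X ≃ᵢ X) a = a
    rw [map_one]; rfl)
  map_mul' γ δ := AddMonoidHom.ext fun a => Subtype.ext (linPart_mul_apply (γ : X ≃ᵢ X) δ a)

lemma coe_linPartTransVec {Γ : Subgroup (X ≃ᵢ X)} (γ : Γ) (a : transVec Γ) :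
    (linPartTransVec Γ γ a : X) = linPart (γ : X ≃ᵢ X) a := rfl

lemma mem_transVec_of_zsmul_mem {Γ N : Subgroup (X ≃ᵢ X)} (hN : IsCompleteNormal Γ N) {k : ℤ}
    (hk : k ≠ 0) {a : X} (ha : a ∈ transVec Γ) (hka : k • a ∈ transVec N) :
    a ∈ transVec N := by
  refine (hN.2.2 (transIso a) ha a (LinearIsometryEquiv.refl ℝ X) fun x => rfl).2
    ⟨?_, fun w _ => rfl⟩
  have h : (k : ℝ) • a ∈ spanOf N := by
    rw [Int.cast_smul_eq_zsmul]; exact Submodule.subset_span hka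
  exact ((spanOf N).smul_mem_iff (by exact_mod_cast hk)).1 h

lemma finite_transVec_inter_closedBall [FiniteDimensional ℝ X] {Γ : Subgroup (X ≃ᵢ X)}
    (hΓ : IsSpaceGroup Γ) (r : ℝ) : {a : X | a ∈ transVec Γ ∧ ‖a‖ ≤ r}.Finite := by
  have : ProperSpace X := FiniteDimensional.proper_real X
  refine Set.Finite.of_finite_image ((hΓ.1 (Metric.closedBall 0 r)
    (isCompact_closedBall 0 r)).subset ?_) transIso_injective.injOn
  rintro _ ⟨a, ⟨ha, har⟩, rfl⟩
  refine ⟨ha, a, ⟨0, ?_, ?_⟩, ?_⟩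
  · simpa using (norm_nonneg a).trans har
  · simp
  · simpa using har

lemma moduleFinite_transVec [FiniteDimensional ℝ X] {Γ : Subgroup (X ≃ᵢ X)}
    (hΓ : IsSpaceGroup Γ) : Module.Finite ℤ (transVec Γ) := by
  have hfin := finite_transVec_inter_closedBall hΓ 1
  have : DiscreteTopology (transVec Γ) := by
    refine discreteTopology_of_isOpen_singleton_zero ?_
    have h1 : ({a : transVec Γ | ‖a‖ < 1} \ {0}).Finite := by
      refine Set.Finite.of_finite_image (hfin.subset ?_) Subtype.val_injective.injOn
      rintro _ ⟨a, ⟨ha, -⟩, rfl⟩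
      exact ⟨a.2, le_of_lt ha⟩
    have h2 : ({0} : Set (transVec Γ)) =
        {a : transVec Γ | ‖a‖ < 1} \ ({a : transVec Γ | ‖a‖ < 1} \ {0}) := by
      ext a
      simp only [Set.mem_singleton_iff, Set.mem_sdiff, Set.mem_ofPred_eq, not_and, not_not]
      constructor
      · rintro rfl; simp
      · rintro ⟨ha, h⟩; exact h ha
    rw [h2]
    exact (isOpen_lt continuous_norm continuous_const).sdiff h1.isClosed
  have : DiscreteTopology (AddSubgroup.toIntSubmodule (transVec Γ)) := this
  exact instModuleFinite_of_discrete_submodule (AddSubgroup.toIntSubmodule (transVec Γ))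

lemma finiteIndex_ker_linPartTransVec [FiniteDimensional ℝ X] {Γ : Subgroup (X ≃ᵢ X)}
    (hΓ : IsSpaceGroup Γ) : (linPartTransVec Γ).ker.FiniteIndex := by
  have := moduleFinite_transVec hΓ
  obtain ⟨s, hs⟩ := Module.Finite.fg_top (R := ℤ) (M := transVec Γ)
  have hfin : ∀ a : transVec Γ, Finite {b : transVec Γ | ‖b‖ ≤ ‖a‖} := fun a =>
    Set.Finite.of_finite_image ((finite_transVec_inter_closedBall hΓ ‖a‖).subset (by
      rintro _ ⟨b, hb, rfl⟩
      exact ⟨b.2, hb⟩)) Subtype.val_injective.injOn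
  let e (q : Γ ⧸ (linPartTransVec Γ).ker) (a : s) : {b : transVec Γ | ‖b‖ ≤ ‖a.1‖} :=
    ⟨linPartTransVec Γ q.out a.1, (norm_linPart (q.out : X ≃ᵢ X) (a.1 : X)).le⟩
  have he : Function.Injective e := by
    intro q r h
    have h1 : (linPartTransVec Γ q.out).toIntLinearMap =
        (linPartTransVec Γ r.out).toIntLinearMap :=
      LinearMap.ext_on hs fun a ha => congrArg Subtype.val (congrFun h ⟨a, ha⟩)
    have h2 : linPartTransVec Γ q.out = linPartTransVec Γ r.out :=
      AddMonoidHom.ext fun a => LinearMap.congr_fun h1 a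
    rw [← QuotientGroup.out_eq' q, ← QuotientGroup.out_eq' r, QuotientGroup.eq,
      MonoidHom.mem_ker, map_mul, ← h2, ← map_mul, inv_mul_cancel, map_one]
  have : Finite (Γ ⧸ (linPartTransVec Γ).ker) := Finite.of_injective e he
  exact Subgroup.finiteIndex_of_finite_quotient

end Isometries

section Homs

variable {n : ℕ} {Γ N : Subgroup (EuclideanSpace ℝ (Fin n) ≃ᵢ EuclideanSpace ℝ (Fin n))}

lemma transIso_mem_TNsub {a : EuclideanSpace ℝ (Fin n)} (ha : a ∈ transVec Γ) :
    transIso a ∈ TNsub Γ N :=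
  Subgroup.mem_sup_left ⟨ha, a, rfl⟩

lemma exists_eq_transIso_mul (hN : ∀ γ ∈ Γ, ∀ ν ∈ N, γ * ν * γ⁻¹ ∈ N)
    {x : EuclideanSpace ℝ (Fin n) ≃ᵢ EuclideanSpace ℝ (Fin n)} (hx : x ∈ TNsub Γ N) :
    ∃ a ∈ transVec Γ, ∃ ν ∈ N, x = transIso a * ν := by
  have hle : Γ ⊓ transSubgroup (EuclideanSpace ℝ (Fin n)) ≤ Subgroup.normalizer N := by
    refine fun γ hγ => Subgroup.mem_normalizer_iff.2 fun ν => ⟨hN γ hγ.1 ν, fun h => ?_⟩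
    have := hN γ⁻¹ (Γ.inv_mem hγ.1) _ h
    convert this using 1
    group
  have hx' : x ∈ (TNsub Γ N : Set _) := hx
  rw [Subgroup.coe_mul_of_left_le_normalizer_right _ _ hle] at hx'
  obtain ⟨t, ⟨ht, a, rfl⟩, ν, hν, rfl⟩ := hx'
  exact ⟨a, ht, ν, hν, rfl⟩

lemma IsEquivariantHomToW.isEquivariantHomModL
    {Ψ : ↥(TNsub Γ N) → EuclideanSpace ℝ (Fin n)} (h : IsEquivariantHomToW Γ N Ψ) :
    IsEquivariantHomModL Γ N Ψ := by
  have h0 : (0 : EuclideanSpace ℝ (Fin n)) ∈ Lset N := (centerLattice N).zero_mem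
  refine ⟨h.1, fun x y => ?_, fun ν x hν => ?_, fun γ hγ b B hp x y hxy => ?_⟩
  · rwa [h.2.1, sub_sub, sub_self]
  · rwa [h.2.2.1 ν x hν, sub_self]
  · rwa [h.2.2.2 γ hγ b B hp x y hxy, sub_self]

lemma IsEquivariantHomModL.sub {ψ θ : ↥(TNsub Γ N) → EuclideanSpace ℝ (Fin n)}
    (hψ : IsEquivariantHomModL Γ N ψ) (hθ : IsEquivariantHomModL Γ N θ) :
    IsEquivariantHomModL Γ N (fun x => ψ x - θ x) := by
  have hL : ∀ {u v w : EuclideanSpace ℝ (Fin n)}, u ∈ Lset N → v ∈ Lset N → u - v = w →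
      w ∈ Lset N := fun hu hv h => h ▸ (centerLattice N).sub_mem hu hv
  refine ⟨fun x => sub_mem (hψ.1 x) (hθ.1 x),
    fun x y => hL (hψ.2.1 x y) (hθ.2.1 x y) (by dsimp only; abel),
    fun ν x hν => hL (hψ.2.2.1 ν x hν) (hθ.2.2.1 ν x hν) (by dsimp only; abel),
    fun γ hγ b B hp x y hxy =>
      hL (hψ.2.2.2 γ hγ b B hp x y hxy) (hθ.2.2.2 γ hγ b B hp x y hxy) ?_⟩
  dsimp only
  rw [map_sub]
  abel

/-- The restriction of a map on `TN` to the translation vectors of `Γ`. -/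
def restrictTrans (ψ : ↥(TNsub Γ N) → EuclideanSpace ℝ (Fin n)) (a : transVec Γ) :
    EuclideanSpace ℝ (Fin n) :=
  ψ ⟨transIso a, transIso_mem_TNsub a.2⟩

lemma IsEquivariantHomModL.restrictTrans_add {ψ : ↥(TNsub Γ N) → EuclideanSpace ℝ (Fin n)}
    (hψ : IsEquivariantHomModL Γ N ψ) (a b : transVec Γ) :
    restrictTrans ψ (a + b) - restrictTrans ψ a - restrictTrans ψ b ∈ centerLattice N := by
  have h : restrictTrans ψ (a + b) = ψ (⟨transIso a, transIso_mem_TNsub a.2⟩ *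
      ⟨transIso b, transIso_mem_TNsub b.2⟩) :=
    congrArg ψ (Subtype.ext (transIso_add (a : EuclideanSpace ℝ (Fin n)) b))
  rw [h]
  exact hψ.2.1 _ _

lemma IsEquivariantHomModL.map_one_mem {ψ : ↥(TNsub Γ N) → EuclideanSpace ℝ (Fin n)}
    (hψ : IsEquivariantHomModL Γ N ψ) : ψ 1 ∈ centerLattice N := by
  have h := (centerLattice N).neg_mem (hψ.2.1 1 1)
  simpa using h

lemma IsEquivariantHomModL.restrictTrans_mem {ψ : ↥(TNsub Γ N) → EuclideanSpace ℝ (Fin n)}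
    (hψ : IsEquivariantHomModL Γ N ψ) {a : transVec Γ}
    (ha : (a : EuclideanSpace ℝ (Fin n)) ∈ transVec N) :
    restrictTrans ψ a ∈ centerLattice N := by
  have h := (centerLattice N).add_mem
    (hψ.2.2.1 ⟨transIso a, transIso_mem_TNsub a.2⟩ 1 ha) hψ.map_one_mem
  rwa [sub_add_cancel, mul_one] at h

lemma IsEquivariantHomModL.restrictTrans_linPart
    {ψ : ↥(TNsub Γ N) → EuclideanSpace ℝ (Fin n)} (hψ : IsEquivariantHomModL Γ N ψ)
    (γ : Γ) (a : transVec Γ) :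
    restrictTrans ψ (linPartTransVec Γ γ a) -
      linPart (γ : EuclideanSpace ℝ (Fin n) ≃ᵢ EuclideanSpace ℝ (Fin n)) (restrictTrans ψ a) ∈
      centerLattice N := by
  obtain ⟨γ, hγ⟩ := γ
  have hp : parts γ (γ 0) γ.toRealLinearIsometryEquiv := fun x => by simp
  have h := hψ.2.2.2 γ hγ _ _ hp ⟨transIso a, transIso_mem_TNsub a.2⟩
    ⟨transIso (linPart γ a), transIso_mem_TNsub (linPartTransVec Γ ⟨γ, hγ⟩ a).2⟩
    (conj_transIso γ a)
  rwa [← linPart_eq_of_parts hp] at h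

lemma IsEquivariantHomModL.sub_restrictTrans_mem (hN : ∀ γ ∈ Γ, ∀ ν ∈ N, γ * ν * γ⁻¹ ∈ N)
    {ψ : ↥(TNsub Γ N) → EuclideanSpace ℝ (Fin n)} (hψ : IsEquivariantHomModL Γ N ψ)
    (x : TNsub Γ N) {a : transVec Γ} {ν : EuclideanSpace ℝ (Fin n) ≃ᵢ EuclideanSpace ℝ (Fin n)}
    (hν : ν ∈ N) (hx : (x : _ ≃ᵢ _) = transIso (a : EuclideanSpace ℝ (Fin n)) * ν) :
    ψ x - restrictTrans ψ a ∈ centerLattice N := by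
  have hν' := hN (transIso a) a.2 ν hν
  have h : x = ⟨_, Subgroup.mem_sup_right hν'⟩ * ⟨transIso a, transIso_mem_TNsub a.2⟩ :=
    Subtype.ext (by rw [hx, Subgroup.coe_mul, inv_mul_cancel_right])
  rw [h]
  exact hψ.2.2.1 _ _ hν'

lemma IsEquivariantHomModL.mem_of_span_eq_top (hN : ∀ γ ∈ Γ, ∀ ν ∈ N, γ * ν * γ⁻¹ ∈ N)
    {ψ : ↥(TNsub Γ N) → EuclideanSpace ℝ (Fin n)} (hψ : IsEquivariantHomModL Γ N ψ)
    {s : Set (transVec Γ)} (hs : Submodule.span ℤ s = ⊤)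
    (h : ∀ a ∈ s, restrictTrans ψ a ∈ centerLattice N) (x : TNsub Γ N) :
    ψ x ∈ centerLattice N := by
  let g : transVec Γ →+ EuclideanSpace ℝ (Fin n) ⧸ centerLattice N :=
    AddMonoidHom.mk' (fun a => QuotientAddGroup.mk (restrictTrans ψ a)) fun a b => by
      rw [← QuotientAddGroup.mk_add, ← sub_eq_zero, ← QuotientAddGroup.mk_sub,
        QuotientAddGroup.eq_zero_iff, ← sub_sub]
      exact hψ.restrictTrans_add a b
  have hg : g.toIntLinearMap = 0 := LinearMap.ext_on hs fun a ha =>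
    (QuotientAddGroup.eq_zero_iff _).2 (h a ha)
  obtain ⟨a, ha, ν, hν, hx⟩ := exists_eq_transIso_mul hN x.2
  have h1 := hψ.sub_restrictTrans_mem hN x (a := ⟨a, ha⟩) hν hx
  have h2 : restrictTrans ψ ⟨a, ha⟩ ∈ centerLattice N :=
    (QuotientAddGroup.eq_zero_iff _).1 (LinearMap.congr_fun hg ⟨a, ha⟩)
  simpa using (centerLattice N).add_mem h1 h2

/-- An equivariant additive map on the translation vectors of `Γ` that kills those of `N`
extends to `TN`. -/
lemma exists_isEquivariantHomToW (hN : ∀ γ ∈ Γ, ∀ ν ∈ N, γ * ν * γ⁻¹ ∈ N)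
    (F : transVec Γ →+ EuclideanSpace ℝ (Fin n)) (hFW : ∀ a, F a ∈ centerSpan N)
    (hFN : ∀ a : transVec Γ, (a : EuclideanSpace ℝ (Fin n)) ∈ transVec N → F a = 0)
    (hFΓ : ∀ (γ : Γ) a, F (linPartTransVec Γ γ a) = linPart (γ : _ ≃ᵢ _) (F a)) :
    ∃ Ψ, IsEquivariantHomToW Γ N Ψ ∧
      ∀ (x : TNsub Γ N) (a : transVec Γ),
        ∀ ν ∈ N, (x : _ ≃ᵢ _) = transIso (a : EuclideanSpace ℝ (Fin n)) * ν → Ψ x = F a := by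
  choose τ hτ μ hμ hτμ using fun x : TNsub Γ N => exists_eq_transIso_mul hN x.2
  let Ψ : TNsub Γ N → EuclideanSpace ℝ (Fin n) := fun x => F ⟨τ x, hτ x⟩
  have key : ∀ (x : TNsub Γ N) (a : transVec Γ),
      ∀ ν ∈ N, (x : _ ≃ᵢ _) = transIso (a : EuclideanSpace ℝ (Fin n)) * ν → Ψ x = F a := by
    intro x a ν hν hx
    rw [← sub_eq_zero, ← map_sub]
    refine hFN _ ?_
    rw [mem_transVec]
    have h1 : transIso (τ x) * μ x = transIso (a : EuclideanSpace ℝ (Fin n)) * ν := by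
      rw [← hτμ, hx]
    have h2 : transIso (τ x - a) = ν * (μ x)⁻¹ := by
      rw [sub_eq_neg_add, transIso_add, transIso_neg, inv_mul_eq_iff_eq_mul, ← mul_assoc, ← h1,
        mul_inv_cancel_right]
    exact h2 ▸ N.mul_mem hν (N.inv_mem (hμ x))
  refine ⟨Ψ, ⟨fun x => hFW _, fun x y => ?_, fun ν x hν => ?_, fun γ hγ b B hp x y hxy => ?_⟩,
    key⟩
  · change _ = F _ + F _
    rw [← map_add]
    refine key _ _ ((transIso (τ y))⁻¹ * μ x * (transIso (τ y))⁻¹⁻¹ * μ y)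
      (N.mul_mem (hN _ (Γ.inv_mem (hτ y)) _ (hμ x)) (hμ y)) ?_
    rw [Subgroup.coe_mul, hτμ x, hτμ y, AddSubgroup.coe_add, transIso_add]
    group
  · refine key _ _ ((transIso (τ x))⁻¹ * ν * (transIso (τ x))⁻¹⁻¹ * μ x)
      (N.mul_mem (hN _ (Γ.inv_mem (hτ x)) _ hν) (hμ x)) ?_
    rw [Subgroup.coe_mul, hτμ x]
    group
  · rw [← linPart_eq_of_parts hp, ← hFΓ ⟨γ, hγ⟩]
    refine key _ _ (γ * μ x * γ⁻¹) (hN γ hγ _ (hμ x)) ?_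
    rw [coe_linPartTransVec, ← conj_transIso, ← hxy, hτμ x]
    group

/-- Every equivariant homomorphism `TN/N → W/L` agrees with one that lifts to `W` up to an
error annihilated by a uniform integer. -/
lemma exists_nsmul_sub_mem (hΓ : IsSpaceGroup Γ) (hN : IsCompleteNormal Γ N)
    {ψ : ↥(TNsub Γ N) → EuclideanSpace ℝ (Fin n)} (hψ : IsEquivariantHomModL Γ N ψ) :
    ∃ Ψ, IsEquivariantHomToW Γ N Ψ ∧
      ∀ x, (linPartTransVec Γ).ker.index • (ψ x - Ψ x) ∈ centerLattice N := by
  have := moduleFinite_transVec hΓ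
  have := finiteIndex_ker_linPartTransVec hΓ
  have hnorm := hN.2.1
  have hker : ∀ γ ∈ (linPartTransVec Γ).ker, ∀ a, linPartTransVec Γ γ a = a := fun γ hγ a => by
    rw [MonoidHom.mem_ker.1 hγ]; rfl
  obtain ⟨F, hFW, hFN, hFΓ, hF⟩ := exists_equivariant_approx (linPartTransVec Γ)
    (linPart.comp Γ.subtype) ((transVec N).addSubgroupOf (transVec Γ)) (centerLattice N)
    (centerSpan N) (fun γ a ha => linPart_mem_transVec hnorm γ.2 ha)
    (fun γ u hu => linPart_mem_centerLattice hnorm γ.2 hu)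
    (fun γ u hu => linPart_mem_centerSpan hnorm γ.2 hu)
    (linPartTransVec Γ).ker hker
    (fun γ hγ u hu => linPart_eq_of_mem_centerSpan hN.1
      (fun a ha => congrArg Subtype.val (hker γ hγ ⟨a, ha⟩)) hu)
    (fun k a hk hka => mem_transVec_of_zsmul_mem hN hk a.2 hka)
    (restrictTrans ψ) (fun a => hψ.1 _) hψ.restrictTrans_add
    (fun a ha => hψ.restrictTrans_mem ha) hψ.restrictTrans_linPart
  obtain ⟨Ψ, hΨ, hΨF⟩ := exists_isEquivariantHomToW hnorm F hFW hFN hFΓ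
  refine ⟨Ψ, hΨ, fun x => ?_⟩
  obtain ⟨a, ha, ν, hν, hx⟩ := exists_eq_transIso_mul hnorm x.2
  rw [hΨF x ⟨a, ha⟩ ν hν hx]
  have h1 := (centerLattice N).add_mem
    ((centerLattice N).nsmul_mem (hψ.sub_restrictTrans_mem hnorm x (a := ⟨a, ha⟩) hν hx)
      (linPartTransVec Γ).ker.index) (hF ⟨a, ha⟩)
  rwa [← smul_add, sub_add_sub_cancel] at h1

lemma moduleFinite_centerLattice (hΓ : IsSpaceGroup Γ) (hNΓ : N ≤ Γ) :
    Module.Finite ℤ (centerLattice N) := by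
  have := moduleFinite_transVec hΓ
  have hle : centerLattice N ≤ transVec Γ := fun u hu => hNΓ (mem_Lset_iff.1 hu).1
  exact Module.Finite.of_injective (AddSubgroup.inclusion hle).toIntLinearMap
    (AddSubgroup.inclusion_injective hle)

end Homs

/-- **Lemma 9**: the cokernel of
`κ_* : Hom_{Γ/N}(TN/N, W) → Hom_{Γ/N}(TN/N, 𝒦)` is finite: finitely many equivariant
homomorphisms `TN/N → 𝒦` represent all cosets of the image of `κ_*`, i.e. the image of
`κ_*` has finite index in `Hom_{Γ/N}(TN/N, 𝒦)`. -/
theorem cokernel_hom_kappa_finite {n : ℕ}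
    (Γ N : Subgroup (EuclideanSpace ℝ (Fin n) ≃ᵢ EuclideanSpace ℝ (Fin n)))
    (hΓ : IsSpaceGroup Γ) (hN : IsCompleteNormal Γ N) :
    ∃ S : Set (↥(TNsub Γ N) → EuclideanSpace ℝ (Fin n)), S.Finite ∧
      (∀ ψ ∈ S, IsEquivariantHomModL Γ N ψ) ∧
      ∀ ψ, IsEquivariantHomModL Γ N ψ →
        ∃ ψ' ∈ S, ∃ Ψ, IsEquivariantHomToW Γ N Ψ ∧
          ∀ x, ψ x - ψ' x - Ψ x ∈ Lset N := by
  obtain ⟨s, hs⟩ := (moduleFinite_transVec hΓ).fg_top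
  have hm : (linPartTransVec Γ).ker.index ≠ 0 :=
    (finiteIndex_ker_linPartTransVec hΓ).index_ne_zero
  set m := (linPartTransVec Γ).ker.index with hm_def
  have := moduleFinite_centerLattice hΓ hN.1
  have := finite_quotient_range_zsmul (centerLattice N) m (by exact_mod_cast hm)
  let D := {θ : ↥(TNsub Γ N) → EuclideanSpace ℝ (Fin n) //
    IsEquivariantHomModL Γ N θ ∧ ∀ x, m • θ x ∈ centerLattice N}
  let Φ : D → s → centerLattice N ⧸ (zsmulAddGroupHom m : centerLattice N →+ _).range :=
    fun θ a => QuotientAddGroup.mk ⟨m • restrictTrans θ.1 a, θ.2.2 _⟩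
  refine ⟨Set.range fun c : Set.range Φ => (Classical.choose c.2).1, Set.finite_range _, ?_, ?_⟩
  · rintro _ ⟨c, rfl⟩
    exact (Classical.choose c.2).2.1
  intro ψ hψ
  obtain ⟨Ψ, hΨ, hm_mem⟩ := exists_nsmul_sub_mem hΓ hN hψ
  let θ : D := ⟨fun x => ψ x - Ψ x, hψ.sub hΨ.isEquivariantHomModL, hm_mem⟩
  have hc : Φ θ ∈ Set.range Φ := ⟨θ, rfl⟩
  refine ⟨_, ⟨⟨Φ θ, hc⟩, rfl⟩, Ψ, hΨ, fun x => ?_⟩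
  have hΦ : Φ (Classical.choose hc) = Φ θ := Classical.choose_spec hc
  change ψ x - (Classical.choose hc).1 x - Ψ x ∈ Lset N
  generalize Classical.choose hc = θ' at hΦ
  rw [sub_right_comm]
  refine (θ.2.1.sub θ'.2.1).mem_of_span_eq_top hN.2.1 hs (fun a ha => ?_) x
  obtain ⟨v, hv⟩ := QuotientAddGroup.eq.1 (congrFun hΦ ⟨a, ha⟩)
  have h : (m : ℝ) • (v : EuclideanSpace ℝ (Fin n)) =
      (m : ℝ) • (restrictTrans θ.1 a - restrictTrans θ'.1 a) := by
    rw [smul_sub, Nat.cast_smul_eq_nsmul, Nat.cast_smul_eq_nsmul, Nat.cast_smul_eq_nsmul,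
      sub_eq_neg_add]
    simpa using congrArg Subtype.val hv
  have h' := smul_right_injective _ (show (m : ℝ) ≠ 0 by exact_mod_cast hm) h
  have hv' := v.2
  rw [h'] at hv'
  exact hv'
end
end

section
/- Let 0 < m < n, let M be an m-space group and let Δ be an (n−m)-space group. Then there are only finitely many isomorphism classes of pairs (Γ, N) such that Γ is an n-space group and N is a complete normal subgroup of Γ with N isomorphic to M and Γ/N isomorphic to Δ; that is, there exists a finite list of such pairs (Γ₁, N₁), …, (Γ_k, N_k) so that every such pair (Γ, N) admits a group isomorphism ζ : Γ → Γ_i with ζ(N) = N_i for some i. -/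
noncomputable section

/-- `IsoClassCondition M Δ Γ N` says that `Γ` is an `n`-space group and `N` is a complete
normal subgroup of `Γ` with `N ≅ M` and `Γ/N ≅ Δ` (the latter expressed by a surjective
homomorphism `Γ → Δ` with kernel `N`). -/
def IsoClassCondition {n m k : ℕ}
    (M : Subgroup (EuclideanSpace ℝ (Fin m) ≃ᵢ EuclideanSpace ℝ (Fin m)))
    (Δ : Subgroup (EuclideanSpace ℝ (Fin k) ≃ᵢ EuclideanSpace ℝ (Fin k)))
    (Γ N : Subgroup (EuclideanSpace ℝ (Fin n) ≃ᵢ EuclideanSpace ℝ (Fin n))) : Prop :=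
  IsSpaceGroup Γ ∧ IsCompleteNormal Γ N ∧
  Nonempty (N ≃* M) ∧
  ∃ q : Γ →* Δ, Function.Surjective q ∧
    ∀ x : Γ, q x = 1 ↔ (x : EuclideanSpace ℝ (Fin n) ≃ᵢ EuclideanSpace ℝ (Fin n)) ∈ N

section LinearPart

variable {E : Type*} [NormedAddCommGroup E] [InnerProductSpace ℝ E]

/-- The linear part `A` of the isometry `a + A`, as a group homomorphism. -/
def linearPart : (E ≃ᵢ E) →* (E ≃ₗᵢ[ℝ] E) where
  toFun f := f.toRealLinearIsometryEquiv
  map_one' := by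
    ext x
    simp [IsometryEquiv.toRealLinearIsometryEquiv_apply]
  map_mul' f g := by
    ext x
    rw [LinearIsometryEquiv.coe_mul, Function.comp_apply,
      IsometryEquiv.toRealLinearIsometryEquiv_apply g, map_sub]
    simp only [IsometryEquiv.toRealLinearIsometryEquiv_apply, IsometryEquiv.mul_apply]
    abel

lemma isometryEquiv_apply (f : E ≃ᵢ E) (x : E) : f x = linearPart f x + f 0 := by
  simp [linearPart, IsometryEquiv.toRealLinearIsometryEquiv_apply]

lemma isometryEquiv_sub (f : E ≃ᵢ E) (x y : E) : f x - f y = linearPart f (x - y) := by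
  rw [isometryEquiv_apply f x, isometryEquiv_apply f y, map_sub]
  abel

lemma linearPart_transIso (a : E) : linearPart (transIso a) = 1 := by
  ext x
  have h := isometryEquiv_apply (transIso a) x
  simp only [transIso_apply, add_zero] at h
  rw [add_comm] at h
  exact (add_right_cancel h).symm

lemma eq_transIso_of_linearPart_eq_one {f : E ≃ᵢ E} (h : linearPart f = 1) :
    f = transIso (f 0) := by
  ext x
  rw [isometryEquiv_apply, h, transIso_apply, add_comm]
  rfl

lemma conj_transIso_s17 (f : E ≃ᵢ E) (a : E) :
    f * transIso a * f⁻¹ = transIso (linearPart f a) := by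
  ext x
  have h := isometryEquiv_sub f (a + f⁻¹ x) (f⁻¹ x)
  rw [add_sub_cancel_right, IsometryEquiv.apply_inv_self] at h
  simp only [IsometryEquiv.mul_apply, transIso_apply]
  rw [← h]
  abel

/-- The vectors `a` such that the translation by `a` lies in `Γ`. -/
def translationLattice (Γ : Subgroup (E ≃ᵢ E)) : AddSubgroup E where
  carrier := {a | transIso a ∈ Γ}
  zero_mem' := by
    have : (transIso (0 : E)) = 1 := by ext x; simp
    simp [this]
  add_mem' {a b} ha hb := by
    have : (transIso (a + b)) = transIso a * transIso b := by
      ext x; simp [IsometryEquiv.mul_apply, add_assoc]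
    simpa [this] using Γ.mul_mem ha hb
  neg_mem' {a} ha := by
    have : (transIso (-a)) = (transIso a)⁻¹ := by
      rw [eq_inv_iff_mul_eq_one]; ext x; simp [IsometryEquiv.mul_apply]
    simpa [this] using Γ.inv_mem ha

omit [InnerProductSpace ℝ E] in
lemma mem_translationLattice {Γ : Subgroup (E ≃ᵢ E)} {a : E} :
    a ∈ translationLattice Γ ↔ transIso a ∈ Γ := Iff.rfl

lemma linearPart_mem_translationLattice {Γ : Subgroup (E ≃ᵢ E)} {γ : E ≃ᵢ E} (hγ : γ ∈ Γ)
    {a : E} (ha : a ∈ translationLattice Γ) : linearPart γ a ∈ translationLattice Γ := by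
  rw [mem_translationLattice, ← conj_transIso_s17]
  exact Γ.mul_mem (Γ.mul_mem hγ ha) (Γ.inv_mem hγ)

lemma sub_mem_translationLattice {Γ : Subgroup (E ≃ᵢ E)} {γ δ : E ≃ᵢ E} (hγ : γ ∈ Γ)
    (hδ : δ ∈ Γ) (h : linearPart γ = linearPart δ) : γ 0 - δ 0 ∈ translationLattice Γ := by
  have h1 : linearPart (γ * δ⁻¹) = 1 := by rw [map_mul, map_inv, h, mul_inv_cancel]
  have h2 := eq_transIso_of_linearPart_eq_one h1
  have h3 : (γ * δ⁻¹) (δ 0) = (γ * δ⁻¹) 0 + δ 0 := by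
    conv_lhs => rw [h2]
    rfl
  rw [IsometryEquiv.mul_apply, IsometryEquiv.inv_apply_self] at h3
  rw [h3, add_sub_cancel_right, mem_translationLattice, ← h2]
  exact Γ.mul_mem hγ (Γ.inv_mem hδ)

end LinearPart

section Contraction

open scoped commutatorElement

/-- A sequence in a finite set takes some value infinitely often. -/
lemma exists_frequent_value {α : Type*} {s : Set α} (hs : s.Finite) {f : ℕ → α}
    (hf : ∀ k, f k ∈ s) : ∃ y ∈ s, ∀ n, ∃ k, n ≤ k ∧ f k = y := by
  have := hs.to_subtype
  obtain ⟨y, hy⟩ := Finite.exists_infinite_fiber (fun k => (⟨f k, hf k⟩ : s))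
  rw [Set.infinite_coe_iff] at hy
  refine ⟨y, y.2, fun n => ?_⟩
  obtain ⟨k, hk, hnk⟩ := hy.exists_gt n
  exact ⟨k, hnk.le, congrArg Subtype.val hk⟩

lemma eq_zero_of_frequently_le {r c d : ℝ} (hr0 : 0 ≤ r) (hr1 : r < 1) (hc : 0 ≤ c)
    (h : ∀ n : ℕ, ∃ k, n ≤ k ∧ c ≤ r ^ k * d) : c = 0 := by
  refine le_antisymm ?_ hc
  have ht : Filter.Tendsto (fun n : ℕ => r ^ n * |d|) Filter.atTop (nhds (0 * |d|)) :=
    (tendsto_pow_atTop_nhds_zero_of_lt_one hr0 hr1).mul_const _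
  rw [zero_mul] at ht
  refine ge_of_tendsto' ht fun n => ?_
  obtain ⟨k, hnk, hk⟩ := h n
  calc c ≤ r ^ k * d := hk
    _ ≤ r ^ k * |d| := by gcongr; exact le_abs_self d
    _ ≤ r ^ n * |d| := by
      gcongr ?_ * _
      exact pow_le_pow_of_le_one hr0 hr1.le hnk

variable {E : Type*} [NormedAddCommGroup E] [InnerProductSpace ℝ E]

/-- If `A - 1 = c • B` where `B` is a contraction preserving a discrete group, then the isometry
`A` fixes this group pointwise. -/
lemma fixes_of_contraction {A : E ≃ₗᵢ[ℝ] E} {L : AddSubgroup E}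
    (hL : ∀ R : ℝ, {x | x ∈ L ∧ ‖x‖ ≤ R}.Finite) (B : E →ₗ[ℝ] E) {c : ℝ} (hc : c ≠ 0)
    (hAB : ∀ x, A x - x = c • B x) (hBL : ∀ x ∈ L, B x ∈ L) {r : ℝ} (hr0 : 0 ≤ r) (hr1 : r < 1)
    (hr : ∀ x, ‖B x‖ ≤ r * ‖x‖) {t : E} (ht : t ∈ L) : A t = t := by
  have hnorm : ∀ k : ℕ, ‖(B ^ k) t‖ ≤ r ^ k * ‖t‖ := by
    intro k
    induction k with
    | zero => simp
    | succ k ih =>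
      rw [pow_succ', Module.End.mul_apply]
      calc ‖B ((B ^ k) t)‖ ≤ r * ‖(B ^ k) t‖ := hr _
        _ ≤ r * (r ^ k * ‖t‖) := by gcongr
        _ = r ^ (k + 1) * ‖t‖ := by ring
  have hmem : ∀ k : ℕ, (B ^ k) t ∈ L := by
    intro k
    induction k with
    | zero => simpa using ht
    | succ k ih =>
      rw [pow_succ', Module.End.mul_apply]
      exact hBL _ ih
  obtain ⟨y, -, hy⟩ := exists_frequent_value (hL ‖t‖) (f := fun k => (B ^ k) t) fun k =>
    ⟨hmem k, (hnorm k).trans (mul_le_of_le_one_left (norm_nonneg _) (pow_le_one₀ hr0 hr1.le))⟩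
  have hy0 : y = 0 := by
    rw [← norm_eq_zero]
    refine eq_zero_of_frequently_le hr0 hr1 (norm_nonneg _) (d := ‖t‖) fun n => ?_
    obtain ⟨k, hnk, hk⟩ := hy n
    exact ⟨k, hnk, hk ▸ hnorm k⟩
  have hker : ∀ y, B (B y) = 0 → B y = 0 := by
    intro y h
    set w := A y - y with hw
    have hAw : A w = w := by
      rw [← sub_eq_zero, hAB w, hw, hAB y, map_smul, h, smul_zero, smul_zero]
    have h0 : inner ℝ w w = 0 := by
      conv_lhs => rw [hw, inner_sub_right]
      rw [← hw]
      conv_lhs => lhs; rw [← hAw]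
      rw [LinearIsometryEquiv.inner_map_map, sub_self]
    rw [inner_self_eq_zero] at h0
    have := hAB y
    rw [← hw, h0] at this
    exact (smul_eq_zero.mp this.symm).resolve_left hc
  have hdown : ∀ k : ℕ, (B ^ (k + 1)) t = 0 → B t = 0 := by
    intro k
    induction k with
    | zero => simp
    | succ k ih =>
      intro h
      apply ih
      rw [pow_succ', Module.End.mul_apply] at h ⊢
      rw [pow_succ', Module.End.mul_apply] at h
      exact hker _ h
  obtain ⟨k, hk1, hk⟩ := hy 1
  obtain ⟨j, rfl⟩ : ∃ j, k = j + 1 := ⟨k - 1, by omega⟩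
  have := hAB t
  rw [hdown j (hk.trans hy0), smul_zero, sub_eq_zero] at this
  exact this

/-- The orthogonal group has no small subgroups. -/
lemma eq_one_of_pow_near_one {C : E ≃ₗᵢ[ℝ] E}
    (h : ∀ (k : ℕ) (x : E), ‖(C ^ k) x - x‖ ≤ 1 / 2 * ‖x‖) : C = 1 := by
  ext y
  set x := C y - y with hx
  have hsum : ∀ N : ℕ, ∑ k ∈ Finset.range N, (C ^ k) x = (C ^ N) y - y := by
    intro N
    have htel := Finset.sum_range_sub (fun k => (C ^ k) y) N
    rw [pow_zero] at htel
    refine Eq.trans (Finset.sum_congr rfl fun k _ => ?_) htel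
    rw [hx, map_sub, pow_succ]
    rfl
  have hle : ∀ N : ℕ, (N : ℝ) * ‖x‖ ≤ ‖y‖ := by
    intro N
    have h1 : ‖∑ k ∈ Finset.range N, ((C ^ k) x - x)‖ ≤ N * (1 / 2 * ‖x‖) := by
      refine (norm_sum_le_of_le _ fun k _ => h k x).trans ?_
      simp
    rw [Finset.sum_sub_distrib, hsum, Finset.sum_const, Finset.card_range,
      ← Nat.cast_smul_eq_nsmul ℝ] at h1
    have h2 : ‖(N : ℝ) • x‖ ≤ ‖(C ^ N) y - y‖ + ‖(C ^ N) y - y - (N : ℝ) • x‖ := by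
      have := norm_sub_le ((C ^ N) y - y) ((C ^ N) y - y - (N : ℝ) • x)
      rwa [sub_sub_cancel] at this
    rw [norm_smul, Real.norm_natCast] at h2
    have h3 := h N y
    linarith
  have hx0 : ‖x‖ = 0 := by
    by_contra hne
    have hpos : 0 < ‖x‖ := lt_of_le_of_ne (norm_nonneg _) (Ne.symm hne)
    obtain ⟨N, hN⟩ := exists_nat_gt (‖y‖ / ‖x‖)
    rw [div_lt_iff₀ hpos] at hN
    linarith [hle N]
  rw [norm_eq_zero, hx, sub_eq_zero] at hx0
  exact hx0

lemma norm_commutator_sub_le {A B : E ≃ₗᵢ[ℝ] E} {ε δ : ℝ} (hε : 0 ≤ ε) (hδ : 0 ≤ δ)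
    (hA : ∀ x, ‖A x - x‖ ≤ ε * ‖x‖) (hB : ∀ x, ‖B x - x‖ ≤ δ * ‖x‖) (x : E) :
    ‖A (B x) - B (A x)‖ ≤ 2 * ε * δ * ‖x‖ := by
  have h : A (B x) - B (A x) = (A (B x - x) - (B x - x)) - (B (A x - x) - (A x - x)) := by
    simp only [map_sub]
    abel
  rw [h]
  refine (norm_sub_le _ _).trans ?_
  have h1 : ‖A (B x - x) - (B x - x)‖ ≤ ε * (δ * ‖x‖) :=
    (hA _).trans (mul_le_mul_of_nonneg_left (hB x) hε)
  have h2 : ‖B (A x - x) - (A x - x)‖ ≤ δ * (ε * ‖x‖) :=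
    (hB _).trans (mul_le_mul_of_nonneg_left (hA x) hδ)
  linarith

lemma norm_commutator_apply_sub_le {A B : E ≃ₗᵢ[ℝ] E} {ε δ : ℝ} (hε : 0 ≤ ε) (hδ : 0 ≤ δ)
    (hA : ∀ x, ‖A x - x‖ ≤ ε * ‖x‖) (hB : ∀ x, ‖B x - x‖ ≤ δ * ‖x‖) (x : E) :
    ‖⁅A, B⁆ x - x‖ ≤ 2 * ε * δ * ‖x‖ := by
  set y := (B * A)⁻¹ x with hy
  have hx : x = (B * A) y := by rw [hy]; simp
  have hn : ‖x‖ = ‖y‖ := by rw [hx, LinearIsometryEquiv.norm_map]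
  have h0 : ⁅A, B⁆ * (B * A) = A * B := by
    rw [commutatorElement_def]
    group
  have h1 : ⁅A, B⁆ x = (A * B) y := by
    rw [← h0, hx]
    rfl
  rw [h1, hn, hx]
  exact norm_commutator_sub_le hε hδ hA hB y

/-- If `A` commutes with the commutator `⁅A, X⁆` and `X` is close to `1`, then `A` commutes
with `X`. -/
lemma commutator_eq_one_of_commutator_commutator_eq_one {A X : E ≃ₗᵢ[ℝ] E}
    (hX : ∀ x, ‖X x - x‖ ≤ 1 / 4 * ‖x‖) (h : ⁅A, ⁅A, X⁆⁆ = 1) : ⁅A, X⁆ = 1 := by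
  have hcomm : A * ⁅A, X⁆ = ⁅A, X⁆ * A := commutatorElement_eq_one_iff_mul_comm.mp h
  have hpow : ∀ k : ℕ, ⁅A, X⁆ ^ k = A ^ k * X * (A ^ k)⁻¹ * X⁻¹ := by
    intro k
    induction k with
    | zero => simp
    | succ k ih =>
      have h1 : A * ⁅A, X⁆ ^ k = ⁅A, X⁆ ^ k * A := (Commute.pow_right hcomm k : _)
      calc ⁅A, X⁆ ^ (k + 1) = ⁅A, X⁆ ^ k * (A * X * A⁻¹ * X⁻¹) := by
            rw [pow_succ, commutatorElement_def A X]
        _ = (⁅A, X⁆ ^ k * A) * (X * A⁻¹ * X⁻¹) := by group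
        _ = A * (A ^ k * X * (A ^ k)⁻¹ * X⁻¹) * (X * A⁻¹ * X⁻¹) := by rw [← h1, ih]
        _ = A ^ (k + 1) * X * (A ^ (k + 1))⁻¹ * X⁻¹ := by
            rw [pow_succ' A k]
            group
  refine eq_one_of_pow_near_one fun k x => ?_
  rw [hpow]
  set y := X⁻¹ x with hy
  have hx : x = X y := by rw [hy]; simp
  set z := (A ^ k)⁻¹ y with hz
  have hyz : y = (A ^ k) z := by rw [hz]; simp
  have h1 : (A ^ k * X * (A ^ k)⁻¹ * X⁻¹) x = (A ^ k) (X z) := by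
    rw [hz, hy]
    rfl
  have h2 : ‖(A ^ k) (X z) - (A ^ k) z‖ ≤ 1 / 4 * ‖x‖ := by
    rw [← map_sub, LinearIsometryEquiv.norm_map, hx, hyz, LinearIsometryEquiv.norm_map,
      LinearIsometryEquiv.norm_map]
    exact hX z
  have h3 : ‖X y - y‖ ≤ 1 / 4 * ‖x‖ := by
    rw [hx, LinearIsometryEquiv.norm_map]
    exact hX y
  rw [h1]
  have h4 : (A ^ k) (X z) - x = ((A ^ k) (X z) - (A ^ k) z) - (X y - y) := by
    rw [← hyz, ← hx]
    abel
  rw [h4]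
  refine (norm_sub_le _ _).trans ?_
  linarith

end Contraction

section Bieberbach

open scoped commutatorElement

variable {E : Type*} [NormedAddCommGroup E] [InnerProductSpace ℝ E]

lemma linearPart_commutatorElement (α β : E ≃ᵢ E) :
    linearPart ⁅α, β⁆ = ⁅linearPart α, linearPart β⁆ := by
  simp only [commutatorElement_def, map_mul, map_inv]

lemma norm_commutator_zero_le {α β : E ≃ᵢ E}
    (hα : ∀ x, ‖linearPart α x - x‖ ≤ 1 / 4 * ‖x‖)
    (hβ : ∀ x, ‖linearPart β x - x‖ ≤ 1 / 4 * ‖x‖) {R : ℝ} (hαR : ‖α 0‖ ≤ R) (hβR : ‖β 0‖ ≤ R) :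
    ‖⁅α, β⁆ 0‖ ≤ R := by
  set q := (β * α)⁻¹ 0 with hq
  have h0 : ⁅α, β⁆ * (β * α) = α * β := by
    rw [commutatorElement_def]
    group
  have hq0 : β (α q) = 0 := by
    have : (β * α) q = 0 := by rw [hq, IsometryEquiv.apply_inv_self]
    exact this
  have h1 : ⁅α, β⁆ 0 = α (β q) := by
    have : (⁅α, β⁆ * (β * α)) q = α (β q) := by rw [h0]; rfl
    rw [← this, IsometryEquiv.mul_apply, IsometryEquiv.mul_apply, hq0]
  have h2 : ⁅α, β⁆ 0 = (linearPart α (linearPart β q) - linearPart β (linearPart α q))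
      + ((linearPart α (β 0) - β 0) - (linearPart β (α 0) - α 0)) := by
    have h3 : ⁅α, β⁆ 0 = α (β q) - β (α q) := by rw [h1, hq0, sub_zero]
    rw [h3, isometryEquiv_apply α (β q), isometryEquiv_apply β (α q), isometryEquiv_apply α q,
      isometryEquiv_apply β q, map_add, map_add]
    abel
  have hqn : ‖q‖ ≤ ‖β 0‖ + ‖α 0‖ := by
    have h3 : (β * α) 0 = - linearPart (β * α) q := by
      have := isometryEquiv_apply (β * α) q
      rw [IsometryEquiv.mul_apply, hq0] at this
      rw [eq_neg_iff_add_eq_zero, add_comm]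
      exact this.symm
    have h4 : ‖q‖ = ‖(β * α) 0‖ := by rw [h3, norm_neg, LinearIsometryEquiv.norm_map]
    rw [h4, IsometryEquiv.mul_apply, isometryEquiv_apply β, add_comm]
    refine (norm_add_le _ _).trans ?_
    rw [LinearIsometryEquiv.norm_map]
  have h5 := norm_commutator_sub_le (by norm_num) (by norm_num) hα hβ q
  rw [h2]
  have h6 := norm_sub_le (linearPart α (β 0) - β 0) (linearPart β (α 0) - α 0)
  have h7 := hα (β 0)
  have h8 := hβ (α 0)
  have h9 := norm_nonneg (α 0)
  refine (norm_add_le _ _).trans ?_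
  linarith

variable {Γ : Subgroup (E ≃ᵢ E)}

section Discrete

variable (hfin : ∀ R : ℝ, {γ | γ ∈ Γ ∧ ‖γ 0‖ ≤ R}.Finite)

include hfin

omit [InnerProductSpace ℝ E] in
lemma finite_translationLattice (R : ℝ) : {x | x ∈ translationLattice Γ ∧ ‖x‖ ≤ R}.Finite := by
  have hinj : Function.Injective (transIso : E → E ≃ᵢ E) := by
    intro a b hab
    have := congrArg (fun f : E ≃ᵢ E => f 0) hab
    simpa using this
  refine ((hfin R).preimage (f := transIso) hinj.injOn).subset ?_
  rintro x ⟨hx, hxR⟩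
  exact ⟨hx, by simpa using hxR⟩

/-- In a discrete group of isometries, elements with linear part close to `1` have commuting
linear parts. -/
lemma commutator_linearPart_eq_one {α β : E ≃ᵢ E} (hαΓ : α ∈ Γ) (hβΓ : β ∈ Γ)
    (hα : ∀ x, ‖linearPart α x - x‖ ≤ 1 / 4 * ‖x‖)
    (hβ : ∀ x, ‖linearPart β x - x‖ ≤ 1 / 4 * ‖x‖) : ⁅linearPart α, linearPart β⁆ = 1 := by
  let s : ℕ → (E ≃ᵢ E) := fun k => (fun δ => ⁅α, δ⁆)^[k] β
  have hs0 : s 0 = β := rfl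
  have hs : ∀ k, s (k + 1) = ⁅α, s k⁆ := fun k => Function.iterate_succ_apply' _ _ _
  have hmem : ∀ k, s k ∈ Γ := by
    intro k
    induction k with
    | zero => exact hβΓ
    | succ k ih =>
      rw [hs, commutatorElement_def]
      exact Γ.mul_mem (Γ.mul_mem (Γ.mul_mem hαΓ ih) (Γ.inv_mem hαΓ)) (Γ.inv_mem ih)
  have hnear : ∀ k x, ‖linearPart (s k) x - x‖ ≤ (1 / 2) ^ k * (1 / 4 * ‖x‖) := by
    intro k
    induction k with
    | zero => simpa [hs0] using hβ
    | succ k ih =>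
      intro x
      rw [hs, linearPart_commutatorElement]
      refine (norm_commutator_apply_sub_le (δ := (1 / 2) ^ k * (1 / 4)) (by norm_num)
        (by positivity) hα (fun y => (ih y).trans_eq (by ring)) x).trans_eq ?_
      ring
  have hnear4 : ∀ k x, ‖linearPart (s k) x - x‖ ≤ 1 / 4 * ‖x‖ := fun k x =>
    (hnear k x).trans (mul_le_of_le_one_left (by positivity)
      (pow_le_one₀ (by norm_num) (by norm_num)))
  have hbound : ∀ k, ‖s k 0‖ ≤ max ‖α 0‖ ‖β 0‖ := by
    intro k
    induction k with
    | zero => exact le_max_right _ _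
    | succ k ih =>
      rw [hs]
      exact norm_commutator_zero_le hα (hnear4 k) (le_max_left _ _) ih
  obtain ⟨γ, -, hγ⟩ := exists_frequent_value (hfin _) (f := s) fun k => ⟨hmem k, hbound k⟩
  have hγ1 : linearPart γ = 1 := by
    ext x
    have : ‖linearPart γ x - x‖ = 0 := by
      refine eq_zero_of_frequently_le (r := 1 / 2) (by norm_num) (by norm_num) (norm_nonneg _)
        (d := 1 / 4 * ‖x‖) fun n => ?_
      obtain ⟨k, hnk, hk⟩ := hγ n
      exact ⟨k, hnk, hk ▸ hnear k x⟩
    rw [norm_eq_zero, sub_eq_zero] at this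
    exact this
  have hdown : ∀ k, linearPart (s (k + 1)) = 1 → linearPart (s 1) = 1 := by
    intro k
    induction k with
    | zero => exact id
    | succ k ih =>
      intro h
      refine ih ?_
      rw [hs, linearPart_commutatorElement] at h ⊢
      rw [hs, linearPart_commutatorElement] at h
      exact commutator_eq_one_of_commutator_commutator_eq_one (hnear4 k) h
  obtain ⟨k, hk1, hk⟩ := hγ 1
  obtain ⟨j, rfl⟩ : ∃ j, k = j + 1 := ⟨k - 1, by omega⟩
  have := hdown j (hk ▸ hγ1)
  rwa [hs, linearPart_commutatorElement] at this

/-- In a discrete group of isometries, elements with linear part close to `1` commute. -/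
lemma commute_of_linearPart_near_one {α β : E ≃ᵢ E} (hαΓ : α ∈ Γ) (hβΓ : β ∈ Γ)
    (hα : ∀ x, ‖linearPart α x - x‖ ≤ 1 / 4 * ‖x‖)
    (hβ : ∀ x, ‖linearPart β x - x‖ ≤ 1 / 4 * ‖x‖) : α * β = β * α := by
  have hfix : ∀ δ ∈ Γ, (∀ x, ‖linearPart δ x - x‖ ≤ 1 / 4 * ‖x‖) →
      ∀ t ∈ translationLattice Γ, linearPart δ t = t := by
    intro δ hδ hnear t ht
    refine fixes_of_contraction (finite_translationLattice hfin)
      ((linearPart δ).toLinearEquiv.toLinearMap - LinearMap.id) one_ne_zero (fun x => ?_)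
      (fun x hx => ?_) (by norm_num : (0 : ℝ) ≤ 1 / 4) (by norm_num) (fun x => hnear x) ht
    · rw [one_smul]
      rfl
    · exact (translationLattice Γ).sub_mem (linearPart_mem_translationLattice hδ hx) hx
  have hlin : linearPart (α * β) = linearPart (β * α) := by
    rw [map_mul, map_mul]
    exact commutatorElement_eq_one_iff_mul_comm.mp
      (commutator_linearPart_eq_one hfin hαΓ hβΓ hα hβ)
  set c := (α * β) 0 - (β * α) 0 with hc
  have hcL : c ∈ translationLattice Γ :=
    sub_mem_translationLattice (Γ.mul_mem hαΓ hβΓ) (Γ.mul_mem hβΓ hαΓ) hlin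
  have hc' : c = (linearPart α (β 0) - β 0) - (linearPart β (α 0) - α 0) := by
    rw [hc, IsometryEquiv.mul_apply, IsometryEquiv.mul_apply, isometryEquiv_apply α (β 0),
      isometryEquiv_apply β (α 0)]
    abel
  have horth : ∀ A : E ≃ₗᵢ[ℝ] E, A c = c → ∀ y, inner ℝ c (A y - y) = 0 := by
    intro A hA y
    rw [inner_sub_right]
    conv_lhs => lhs; rw [← hA]
    rw [LinearIsometryEquiv.inner_map_map, sub_self]
  have hc0 : c = 0 := by
    rw [← inner_self_eq_zero (𝕜 := ℝ)]
    conv_lhs => rhs; rw [hc']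
    rw [inner_sub_right, horth _ (hfix α hαΓ hα c hcL), horth _ (hfix β hβΓ hβ c hcL), sub_zero]
  ext x
  rw [isometryEquiv_apply (α * β), isometryEquiv_apply (β * α), hlin,
    sub_eq_zero.mp (hc.symm.trans hc0)]

end Discrete

lemma linearPart_eq_one_of_bounded {α : E ≃ᵢ E} {D : ℝ} (h : ∀ x, ‖α x - x‖ ≤ D) :
    linearPart α = 1 := by
  ext x
  have h1 : ∀ n : ℕ, (n : ℝ) * ‖linearPart α x - x‖ ≤ D + ‖α 0‖ := by
    intro n
    have h2 : (n : ℝ) • (linearPart α x - x) = (α ((n : ℝ) • x) - (n : ℝ) • x) - α 0 := by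
      rw [isometryEquiv_apply α, map_smul, smul_sub]
      abel
    calc (n : ℝ) * ‖linearPart α x - x‖ = ‖(n : ℝ) • (linearPart α x - x)‖ := by
          rw [norm_smul, Real.norm_natCast]
      _ ≤ _ := by
          rw [h2]
          exact (norm_sub_le _ _).trans (by gcongr; exact h _)
  have h3 : ‖linearPart α x - x‖ = 0 := by
    by_contra hne
    have hpos : 0 < ‖linearPart α x - x‖ := lt_of_le_of_ne (norm_nonneg _) (Ne.symm hne)
    obtain ⟨N, hN⟩ := exists_nat_gt ((D + ‖α 0‖) / ‖linearPart α x - x‖)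
    rw [div_lt_iff₀ hpos] at hN
    linarith [h1 N]
  rw [norm_eq_zero, sub_eq_zero] at h3
  exact h3

variable [FiniteDimensional ℝ E]

lemma IsSpaceGroup.finite_norm_le (hΓ : IsSpaceGroup Γ) (R : ℝ) :
    {γ | γ ∈ Γ ∧ ‖γ 0‖ ≤ R}.Finite := by
  have := FiniteDimensional.proper ℝ E
  refine (hΓ.1 _ (isCompact_closedBall (0 : E) |R|)).subset ?_
  rintro γ ⟨hγ, hR⟩
  refine ⟨hγ, γ 0, ⟨0, by simp, rfl⟩, ?_⟩
  simpa using hR.trans (le_abs_self R)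

lemma exists_finite_linearPart_cover (Γ : Subgroup (E ≃ᵢ E)) :
    ∃ F : Set (E ≃ᵢ E), F.Finite ∧ F ⊆ Γ ∧ ∀ γ ∈ Γ, ∃ δ ∈ F,
      ∀ x, ‖linearPart (γ * δ⁻¹) x - x‖ ≤ 1 / 4 * ‖x‖ := by
  let f : (E ≃ᵢ E) → (E →L[ℝ] E) := fun γ => (linearPart γ).toContinuousLinearEquiv
  have := FiniteDimensional.proper ℝ (E →L[ℝ] E)
  have htb : TotallyBounded (f '' Γ) := by
    refine (isCompact_closedBall (0 : E →L[ℝ] E) 1).totallyBounded.subset ?_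
    rintro _ ⟨γ, -, rfl⟩
    rw [mem_closedBall_zero_iff]
    refine ContinuousLinearMap.opNorm_le_bound _ zero_le_one fun x => ?_
    rw [one_mul]
    exact ((linearPart γ).norm_map x).le
  obtain ⟨t, hts, htfin, hcov⟩ := Metric.finite_approx_of_totallyBounded htb (1 / 4)
    (by norm_num)
  obtain ⟨F, hFΓ, hFfin, hFt⟩ := Set.exists_subset_image_finite_and.mp ⟨t, hts, htfin, rfl⟩
  refine ⟨F, hFfin, hFΓ, fun γ hγ => ?_⟩
  have hmem := hcov ⟨γ, hγ, rfl⟩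
  simp only [Set.mem_iUnion] at hmem
  obtain ⟨y, hy, hyγ⟩ := hmem
  rw [hFt] at hy
  obtain ⟨δ, hδ, rfl⟩ := hy
  refine ⟨δ, hδ, fun x => ?_⟩
  rw [Metric.mem_ball, dist_eq_norm] at hyγ
  set y := (linearPart δ)⁻¹ x with hy
  have hxy : x = linearPart δ y := by rw [hy]; simp
  have h1 : linearPart (γ * δ⁻¹) x = linearPart γ y := by
    rw [map_mul, map_inv, hy]
    rfl
  have h2 : ‖x‖ = ‖y‖ := by rw [hxy, LinearIsometryEquiv.norm_map]
  rw [h1, h2, hxy]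
  exact ((f γ - f δ).le_opNorm y).trans (by gcongr)

/-- The first Bieberbach theorem in effective form: the translations in a space group are
relatively dense. -/
lemma IsSpaceGroup.exists_norm_sub_le (hΓ : IsSpaceGroup Γ) :
    ∃ R : ℝ, ∀ x : E, ∃ t ∈ translationLattice Γ, ‖x - t‖ ≤ R := by
  obtain ⟨K, hK, hKcov⟩ := hΓ.2
  obtain ⟨F, hFfin, hFΓ, hF⟩ := exists_finite_linearPart_cover Γ
  have hbdd : Bornology.IsBounded (⋃ δ ∈ F, (δ : E → E) '' K) :=
    (Bornology.isBounded_biUnion hFfin).mpr fun δ _ =>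
      (hK.image δ.continuous).isBounded
  obtain ⟨R, hR⟩ := hbdd.exists_norm_le
  have hcov : ∀ x : E, ∃ σ ∈ Γ, (∀ y, ‖linearPart σ y - y‖ ≤ 1 / 4 * ‖y‖) ∧
      ∃ y, ‖y‖ ≤ R ∧ x = σ y := by
    intro x
    obtain ⟨γ, hγ, hγx⟩ := hKcov x
    obtain ⟨δ, hδ, hnear⟩ := hF γ⁻¹ (Γ.inv_mem hγ)
    refine ⟨γ⁻¹ * δ⁻¹, Γ.mul_mem (Γ.inv_mem hγ) (Γ.inv_mem (hFΓ hδ)), hnear, δ (γ x), ?_, ?_⟩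
    · exact hR _ (Set.mem_biUnion hδ ⟨_, hγx, rfl⟩)
    · simp [IsometryEquiv.mul_apply]
  have htrans : ∀ α ∈ Γ, (∀ y, ‖linearPart α y - y‖ ≤ 1 / 4 * ‖y‖) → linearPart α = 1 := by
    intro α hα hnear
    refine linearPart_eq_one_of_bounded (D := ‖α 0‖ + 2 * R) fun x => ?_
    obtain ⟨σ, hσ, hσnear, y, hy, rfl⟩ := hcov x
    have hcomm := commute_of_linearPart_near_one hΓ.finite_norm_le hα hσ hnear hσnear
    have h1 : α (σ y) = σ (α y) := congrArg (fun f : E ≃ᵢ E => f y) hcomm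
    rw [h1, isometryEquiv_sub, LinearIsometryEquiv.norm_map, isometryEquiv_apply α y]
    have h2 : linearPart α y + α 0 - y = α 0 + (linearPart α y - y) := by abel
    rw [h2]
    have h3 := norm_sub_le (linearPart α y) y
    rw [LinearIsometryEquiv.norm_map] at h3
    refine (norm_add_le _ _).trans ?_
    linarith
  refine ⟨R, fun x => ?_⟩
  obtain ⟨σ, hσ, hσnear, y, hy, rfl⟩ := hcov x
  have h1 := htrans σ hσ hσnear
  refine ⟨σ 0, ?_, ?_⟩
  · rw [mem_translationLattice, ← eq_transIso_of_linearPart_eq_one h1]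
    exact hσ
  · rw [isometryEquiv_sub, LinearIsometryEquiv.norm_map, sub_zero]
    exact hy

/-- The first Bieberbach theorem: the translations in a space group span the whole space. -/
lemma IsSpaceGroup.span_translationLattice (hΓ : IsSpaceGroup Γ) :
    Submodule.span ℝ (translationLattice Γ : Set E) = ⊤ := by
  obtain ⟨R, hR⟩ := hΓ.exists_norm_sub_le
  rw [← Submodule.orthogonal_eq_bot_iff, Submodule.eq_bot_iff]
  intro w hw
  by_contra hw0
  have hpos : 0 < ‖w‖ := norm_pos_iff.mpr hw0
  obtain ⟨N, hN⟩ := exists_nat_gt (R / ‖w‖)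
  rw [div_lt_iff₀ hpos] at hN
  obtain ⟨t, ht, htR⟩ := hR ((N : ℝ) • w)
  have hortho : inner ℝ t w = 0 := hw t (Submodule.subset_span ht)
  have h1 : inner ℝ ((N : ℝ) • w - t) w = (N : ℝ) * ‖w‖ ^ 2 := by
    rw [inner_sub_left, hortho, sub_zero, real_inner_smul_left, real_inner_self_eq_norm_sq]
  have h2 := real_inner_le_norm ((N : ℝ) • w - t) w
  rw [h1] at h2
  nlinarith

end Bieberbach

section ReducedFamily

/-- Simultaneous Diophantine approximation. -/
lemma exists_simultaneous_approx {ι : Type*} [Fintype ι] (c : ι → ℝ) {n : ℕ} (hn : 0 < n) :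
    ∃ q : ℕ, 0 < q ∧ q ≤ n ^ Fintype.card ι ∧
      ∃ z : ι → ℤ, ∀ i, |(q : ℝ) * c i - z i| < 1 / n := by
  classical
  have hn' : (0 : ℝ) < n := by exact_mod_cast hn
  have hlt : ∀ x : ℝ, ⌊(n : ℝ) * Int.fract x⌋₊ < n := fun x => by
    rw [Nat.floor_lt (by positivity)]
    exact mul_lt_of_lt_one_right hn' (Int.fract_lt_one x)
  let f : Fin (n ^ Fintype.card ι + 1) → (ι → Fin n) := fun j i =>
    ⟨⌊(n : ℝ) * Int.fract ((j : ℕ) * c i)⌋₊, hlt _⟩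
  have hclose : ∀ a b : Fin (n ^ Fintype.card ι + 1), a < b → f a = f b →
      ∃ q : ℕ, 0 < q ∧ q ≤ n ^ Fintype.card ι ∧
        ∃ z : ι → ℤ, ∀ i, |(q : ℝ) * c i - z i| < 1 / n := by
    intro a b hab hf
    refine ⟨b - a, Nat.sub_pos_of_lt hab, (Nat.sub_le _ _).trans (Nat.lt_succ_iff.mp b.2),
      fun i => ⌊((b : ℕ) : ℝ) * c i⌋ - ⌊((a : ℕ) : ℝ) * c i⌋, fun i => ?_⟩
    have hfi : ⌊(n : ℝ) * Int.fract (((a : ℕ) : ℝ) * c i)⌋₊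
        = ⌊(n : ℝ) * Int.fract (((b : ℕ) : ℝ) * c i)⌋₊ := congrArg Fin.val (congrFun hf i)
    have h1 := Nat.floor_le (a := (n : ℝ) * Int.fract (((a : ℕ) : ℝ) * c i)) (by positivity)
    have h2 := Nat.lt_floor_add_one ((n : ℝ) * Int.fract (((a : ℕ) : ℝ) * c i))
    have h3 := Nat.floor_le (a := (n : ℝ) * Int.fract (((b : ℕ) : ℝ) * c i)) (by positivity)
    have h4 := Nat.lt_floor_add_one ((n : ℝ) * Int.fract (((b : ℕ) : ℝ) * c i))
    rw [hfi] at h1 h2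
    have h5 : (((b - a : ℕ) : ℕ) : ℝ) * c i -
          ((⌊((b : ℕ) : ℝ) * c i⌋ - ⌊((a : ℕ) : ℝ) * c i⌋ : ℤ) : ℝ)
        = Int.fract (((b : ℕ) : ℝ) * c i) - Int.fract (((a : ℕ) : ℝ) * c i) := by
      rw [Nat.cast_sub hab.le, Int.fract, Int.fract]
      push_cast
      ring
    rw [h5, lt_div_iff₀ hn', ← abs_of_pos hn', ← abs_mul, abs_lt]
    constructor <;> nlinarith
  obtain ⟨a, b, hab, hf⟩ := Fintype.exists_ne_map_eq_of_card_lt f (by simp)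
  rcases lt_or_gt_of_ne hab with h | h
  · exact hclose a b h hf
  · exact hclose b a h hf.symm

/-- A finite set contains a basis of its span with respect to which all its elements have
coordinates in `[-1, 1]`. -/
lemma exists_basis_coord_le_one {E : Type*} [AddCommGroup E] [Module ℝ E]
    [FiniteDimensional ℝ E] {s : Set E} (hs : s.Finite) :
    ∃ (d : ℕ) (v : Fin d → E), d = Module.finrank ℝ (Submodule.span ℝ s) ∧ (∀ i, v i ∈ s) ∧
      LinearIndependent ℝ v ∧ ∀ w ∈ s, ∃ c : Fin d → ℝ, (∀ j, |c j| ≤ 1) ∧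
        w = ∑ j, c j • v j := by
  classical
  obtain ⟨f, hfs, -, hfli⟩ := Submodule.exists_fun_fin_finrank_span_eq ℝ s
  let U := Submodule.span ℝ s
  have := hs.to_subtype
  have hsU : ∀ w ∈ s, w ∈ U := fun w hw => Submodule.subset_span hw
  let b := Module.finBasis ℝ U
  let incl : (Fin (Module.finrank ℝ U) → s) → (Fin (Module.finrank ℝ U) → U) :=
    fun g i => ⟨g i, hsU _ (g i).2⟩
  let f0 : Fin (Module.finrank ℝ U) → s := fun i => ⟨f i, hfs i⟩
  have : Nonempty (Fin (Module.finrank ℝ U) → s) := ⟨f0⟩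
  obtain ⟨g, hg⟩ := Finite.exists_max (fun g => |b.det (incl g)|)
  have hf0 : b.det (incl f0) ≠ 0 := by
    have hli : LinearIndependent ℝ (incl f0) := LinearIndependent.of_comp U.subtype hfli
    exact (b.is_basis_iff_det.mp
      ⟨hli, hli.span_eq_top_of_card_eq_finrank' (by simp)⟩).ne_zero
  have hg0 : b.det (incl g) ≠ 0 := by
    rw [← abs_pos]
    exact (abs_pos.mpr hf0).trans_le (hg f0)
  obtain ⟨hgli, hgspan⟩ := b.is_basis_iff_det.mpr hg0.isUnit
  refine ⟨_, fun i => g i, rfl, fun i => (g i).2, hgli.map' U.subtype (by simp), fun w hw => ?_⟩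
  let B := Module.Basis.mk hgli hgspan.ge
  refine ⟨fun j => B.coord j ⟨w, hsU w hw⟩, fun j => ?_, ?_⟩
  · have h1 := congrArg (fun φ => φ (⟨w, hsU w hw⟩ : U))
      (b.det_smul_mk_coord_eq_det_update hgli hgspan.ge j)
    have h2 : Function.update (incl g) j ⟨w, hsU w hw⟩ = incl (Function.update g j ⟨w, hw⟩) := by
      ext i
      by_cases hij : i = j
      · subst hij
        simp [incl]
      · simp [incl, hij]
    simp only [LinearMap.smul_apply, MultilinearMap.toLinearMap_apply, smul_eq_mul] at h1
    have h3 := hg (Function.update g j ⟨w, hw⟩)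
    rw [← h2] at h3
    have h4 : b.det (Function.update (incl g) j ⟨w, hsU w hw⟩)
        = b.det (incl g) * B.coord j ⟨w, hsU w hw⟩ := h1.symm
    rw [h4, abs_mul] at h3
    exact (mul_le_iff_le_one_right (abs_pos.mpr hg0)).mp h3
  · have h1 := B.sum_repr ⟨w, hsU w hw⟩
    have h2 := congrArg U.subtype h1
    rw [map_sum] at h2
    refine h2.symm.trans (Finset.sum_congr rfl fun i _ => ?_)
    rw [map_smul, Module.Basis.mk_apply]
    rfl

variable {E : Type*} [NormedAddCommGroup E] [InnerProductSpace ℝ E]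

/-- A linearly independent family in `L` generating a subgroup of exponent dividing `K` in `L`,
and on which the elements of `G` act by matrices with entries in `[-1, 1]`. -/
structure IsReducedFamily {ι : Type*} [Fintype ι] (G : Subgroup (E ≃ₗᵢ[ℝ] E))
    (L : AddSubgroup E) (K : ℕ) (v : ι → E) : Prop where
  linearIndependent : LinearIndependent ℝ v
  mem : ∀ i, v i ∈ L
  exponent : ∀ x ∈ L, ∃ z : ι → ℤ, (K : ℝ) • x = ∑ i, (z i : ℝ) • v i
  coord_le : ∀ g ∈ G, ∀ i, ∃ c : ι → ℝ, (∀ j, |c j| ≤ 1) ∧ g (v i) = ∑ j, c j • v j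

lemma IsReducedFamily.of_dvd {ι : Type*} [Fintype ι] {G : Subgroup (E ≃ₗᵢ[ℝ] E)}
    {L : AddSubgroup E} {K K' : ℕ} {v : ι → E} (h : IsReducedFamily G L K v) (hK : K ∣ K') :
    IsReducedFamily G L K' v := by
  refine ⟨h.linearIndependent, h.mem, fun x hx => ?_, h.coord_le⟩
  obtain ⟨m, rfl⟩ := hK
  obtain ⟨z, hz⟩ := h.exponent x hx
  refine ⟨fun i => m * z i, ?_⟩
  rw [mul_comm K m, Nat.cast_mul, mul_smul, hz, Finset.smul_sum]
  refine Finset.sum_congr rfl fun i _ => ?_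
  push_cast
  rw [mul_smul]

lemma IsReducedFamily.subset_span {ι : Type*} [Fintype ι] {G : Subgroup (E ≃ₗᵢ[ℝ] E)}
    {L : AddSubgroup E} {K : ℕ} {v : ι → E} (h : IsReducedFamily G L K v) (hK : 0 < K) :
    (L : Set E) ⊆ Submodule.span ℝ (Set.range v) := by
  intro x hx
  obtain ⟨z, hz⟩ := h.exponent x hx
  have hmem : (K : ℝ) • x ∈ Submodule.span ℝ (Set.range v) := by
    rw [hz]
    exact Submodule.sum_mem _ fun i _ =>
      Submodule.smul_mem _ _ (Submodule.subset_span (Set.mem_range_self i))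
  exact (Submodule.smul_mem_iff _ (by exact_mod_cast hK.ne')).mp hmem

variable [FiniteDimensional ℝ E] {L : AddSubgroup E}

/-- The vectors of minimal length of a discrete group contain a reduced family of their span. -/
lemma exists_isReducedFamily_minimal {G : Subgroup (E ≃ₗᵢ[ℝ] E)}
    (hL : ∀ R : ℝ, {x | x ∈ L ∧ ‖x‖ ≤ R}.Finite) (hG : ∀ g ∈ G, ∀ x ∈ L, g x ∈ L) (hL0 : L ≠ ⊥) :
    ∃ (d : ℕ) (v : Fin d → E), 0 < d ∧
      IsReducedFamily G (L ⊓ (Submodule.span ℝ (Set.range v)).toAddSubgroup)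
        (Module.finrank ℝ E ^ Module.finrank ℝ E).factorial v := by
  obtain ⟨x₀, hx₀L, hx₀⟩ := L.bot_or_exists_ne_zero.resolve_left hL0
  obtain ⟨x₁, ⟨⟨hx₁L, -⟩, hx₁0⟩, hmin⟩ :=
    Set.exists_min_image ({x | x ∈ L ∧ ‖x‖ ≤ ‖x₀‖} \ {0}) (fun x => ‖x‖)
      ((hL ‖x₀‖).subset Set.sdiff_subset) ⟨x₀, ⟨hx₀L, le_rfl⟩, hx₀⟩
  have hx₁0 : x₁ ≠ 0 := hx₁0
  have hpos : 0 < ‖x₁‖ := norm_pos_iff.mpr hx₁0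
  have hmin' : ∀ x ∈ L, ‖x‖ < ‖x₁‖ → x = 0 := by
    intro x hx hlt
    by_contra hne
    have hle : ‖x₁‖ ≤ ‖x₀‖ := hmin x₀ ⟨⟨hx₀L, le_rfl⟩, hx₀⟩
    exact absurd (hmin x ⟨⟨hx, hlt.le.trans hle⟩, hne⟩) (not_le.mpr hlt)
  set s : Set E := {x | x ∈ L ∧ ‖x‖ = ‖x₁‖} with hs
  have hsfin : s.Finite := (hL ‖x₁‖).subset fun x hx => ⟨hx.1, hx.2.le⟩
  obtain ⟨d, v, hd, hvs, hvli, hvc⟩ := exists_basis_coord_le_one hsfin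
  set n := Module.finrank ℝ E with hn
  have hdpos : 0 < d := by
    rw [hd, Module.finrank_pos_iff_exists_ne_zero]
    refine ⟨⟨x₁, Submodule.subset_span ⟨hx₁L, rfl⟩⟩, fun h => hx₁0 (congrArg Subtype.val h)⟩
  have hdn : d ≤ n := hd.trans_le <| Submodule.finrank_le _
  have hnpos : 0 < n := hdpos.trans_le hdn
  refine ⟨d, v, hdpos, hvli, fun i => ⟨(hvs i).1, Submodule.subset_span (Set.mem_range_self i)⟩,
    fun x hx => ?_, fun g hg i => ?_⟩
  · obtain ⟨c, hc⟩ := (Submodule.mem_span_range_iff_exists_fun ℝ).mp hx.2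
    obtain ⟨q, hq0, hqn, z, hz⟩ := exists_simultaneous_approx c hnpos
    rw [Fintype.card_fin] at hqn
    have hsum : (q : ℝ) • x - ∑ i, (z i : ℝ) • v i = ∑ i, ((q : ℝ) * c i - z i) • v i := by
      rw [← hc, Finset.smul_sum, ← Finset.sum_sub_distrib]
      exact Finset.sum_congr rfl fun i _ => by rw [sub_smul, mul_smul]
    have hzero : (q : ℝ) • x - ∑ i, (z i : ℝ) • v i = 0 := by
      refine hmin' _ (L.sub_mem ?_ (L.sum_mem fun i _ => ?_)) ?_
      · rw [Nat.cast_smul_eq_nsmul]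
        exact L.nsmul_mem hx.1 q
      · rw [Int.cast_smul_eq_zsmul]
        exact L.zsmul_mem (hvs i).1 _
      · rw [hsum]
        have hn' : (0 : ℝ) < n := by exact_mod_cast hnpos
        have : Nonempty (Fin d) := ⟨⟨0, hdpos⟩⟩
        calc ‖∑ i, ((q : ℝ) * c i - z i) • v i‖
            ≤ ∑ i, ‖((q : ℝ) * c i - z i) • v i‖ := norm_sum_le _ _
          _ < ∑ _i : Fin d, 1 / n * ‖x₁‖ := by
              refine Finset.sum_lt_sum_of_nonempty Finset.univ_nonempty fun i _ => ?_
              rw [norm_smul, (hvs i).2, Real.norm_eq_abs]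
              exact mul_lt_mul_of_pos_right (hz i) hpos
          _ = (d / n) * ‖x₁‖ := by
              rw [Finset.sum_const, Finset.card_univ, Fintype.card_fin, nsmul_eq_mul]
              ring
          _ ≤ 1 * ‖x₁‖ := by
              gcongr
              rw [div_le_one hn']
              exact_mod_cast hdn
          _ = ‖x₁‖ := one_mul _
    obtain ⟨m, hm⟩ : q ∣ (n ^ n).factorial :=
      Nat.dvd_factorial hq0 (hqn.trans (Nat.pow_le_pow_right hnpos hdn))
    refine ⟨fun i => m * z i, ?_⟩
    rw [hm, mul_comm q m, Nat.cast_mul, mul_smul, sub_eq_zero.mp hzero, Finset.smul_sum]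
    refine Finset.sum_congr rfl fun i _ => ?_
    push_cast
    rw [mul_smul]
  · exact hvc _ ⟨hG g hg _ (hvs i).1, by rw [LinearIsometryEquiv.norm_map, (hvs i).2]⟩

end ReducedFamily

section Glue

variable {E : Type*} [NormedAddCommGroup E] [InnerProductSpace ℝ E]

lemma IsReducedFamily.reindex {ι κ : Type*} [Fintype ι] [Fintype κ] {G : Subgroup (E ≃ₗᵢ[ℝ] E)}
    {L : AddSubgroup E} {K : ℕ} {v : ι → E} (h : IsReducedFamily G L K v) (e : κ ≃ ι) :
    IsReducedFamily G L K (v ∘ e) := by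
  refine ⟨h.linearIndependent.comp e e.injective, fun i => h.mem _, fun x hx => ?_,
    fun g hg i => ?_⟩
  · obtain ⟨z, hz⟩ := h.exponent x hx
    exact ⟨z ∘ e, hz.trans (Equiv.sum_comp e fun i => (z i : ℝ) • v i).symm⟩
  · obtain ⟨c, hc1, hc⟩ := h.coord_le g hg (e i)
    exact ⟨c ∘ e, fun j => hc1 _, hc.trans (Equiv.sum_comp e fun i => c i • v i).symm⟩

/-- A family of lifts can be averaged over a finite group to become equivariant. -/
lemma exists_equivariant_lift {ι : Type*} [Fintype ι] {G : Subgroup (E ≃ₗᵢ[ℝ] E)} [Finite G]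
    {L : AddSubgroup E} {K : ℕ} (hG : ∀ g ∈ G, ∀ x ∈ L, g x ∈ L) (π : E →ₗ[ℝ] E)
    (hπ : ∀ g ∈ G, ∀ x, π (g x) = g (π x)) {v : ι → E} (hK : 0 < K)
    (h : IsReducedFamily G (L.map π.toAddMonoidHom) K v) :
    ∃ τ : E →ₗ[ℝ] E, (∀ i, τ (v i) ∈ L) ∧ (∀ i, π (τ (v i)) = ((Nat.card G * K : ℕ) : ℝ) • v i) ∧
      ∀ g ∈ G, ∀ x, g (τ x) = τ (g x) := by
  classical
  have := Fintype.ofFinite G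
  choose w hwL hw using h.mem
  have hw : ∀ i, π (w i) = v i := hw
  obtain ⟨σ, hσ⟩ := LinearMap.exists_extend
    ((Module.Basis.span h.linearIndependent).constr ℝ w)
  have hσv : ∀ i, σ (v i) = w i := fun i => by
    have h1 := congrArg (fun f => f (Module.Basis.span h.linearIndependent i)) hσ
    rw [LinearMap.comp_apply, Module.Basis.constr_basis] at h1
    rwa [Submodule.subtype_apply, Module.Basis.span_apply] at h1
  have hgv : ∀ g ∈ G, ∀ i, g (v i) ∈ L.map π.toAddMonoidHom := fun g hg i =>
    ⟨g (w i), hG g hg _ (hwL i), by rw [← hw i]; exact hπ g hg _⟩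
  have hπσ : ∀ x ∈ L.map π.toAddMonoidHom, π (σ x) = x := by
    intro x hx
    have h1 := h.subset_span hK hx
    clear hx
    induction h1 using Submodule.span_induction with
    | mem x hx => obtain ⟨i, rfl⟩ := hx; rw [hσv, hw]
    | zero => simp
    | add x y _ _ hx hy => rw [map_add, map_add, hx, hy]
    | smul a x _ hx => rw [map_smul, map_smul, hx]
  have hKσ : ∀ x ∈ L.map π.toAddMonoidHom, (K : ℝ) • σ x ∈ L := by
    intro x hx
    obtain ⟨z, hz⟩ := h.exponent x hx
    rw [← map_smul, hz, map_sum]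
    refine L.sum_mem fun i _ => ?_
    rw [map_smul, hσv, Int.cast_smul_eq_zsmul]
    exact L.zsmul_mem (hwL i) _
  let τ : E →ₗ[ℝ] E := (K : ℝ) • ∑ g : G,
    (g : E ≃ₗᵢ[ℝ] E).toLinearEquiv.toLinearMap ∘ₗ σ ∘ₗ
      ((g : E ≃ₗᵢ[ℝ] E)⁻¹).toLinearEquiv.toLinearMap
  have hτ : ∀ x, τ x = ∑ g : G, (g : E ≃ₗᵢ[ℝ] E) ((K : ℝ) • σ ((g : E ≃ₗᵢ[ℝ] E)⁻¹ x)) := by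
    intro x
    simp only [τ, LinearMap.smul_apply, LinearMap.sum_apply, Finset.smul_sum, map_smul]
    rfl
  refine ⟨τ, fun i => ?_, fun i => ?_, fun g hg x => ?_⟩
  · rw [hτ]
    exact L.sum_mem fun g _ => hG _ g.2 _ (hKσ _ (hgv _ (g⁻¹).2 i))
  · rw [hτ, map_sum]
    have : ∀ g : G,
        π ((g : E ≃ₗᵢ[ℝ] E) ((K : ℝ) • σ ((g : E ≃ₗᵢ[ℝ] E)⁻¹ (v i)))) = (K : ℝ) • v i := by
      intro g
      rw [hπ _ g.2, map_smul, hπσ _ (hgv _ (G.inv_mem g.2) i), map_smul]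
      congr 1
      exact (g : E ≃ₗᵢ[ℝ] E).apply_symm_apply (v i)
    rw [Finset.sum_congr rfl fun g _ => this g, Finset.sum_const, Finset.card_univ,
      ← Nat.card_eq_fintype_card, ← Nat.cast_smul_eq_nsmul ℝ, smul_smul, Nat.cast_mul]
  · rw [hτ, hτ, map_sum]
    refine Fintype.sum_equiv (Equiv.mulLeft (⟨g, hg⟩ : G)) _ _ fun k => ?_
    have : (((⟨g, hg⟩ * k : G) : E ≃ₗᵢ[ℝ] E)⁻¹) (g x) = (k : E ≃ₗᵢ[ℝ] E)⁻¹ x := by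
      rw [Subgroup.coe_mul, mul_inv_rev]
      exact congrArg _ (g.symm_apply_apply x)
    rw [Equiv.coe_mulLeft, this]
    rfl

lemma IsReducedFamily.exists_glue {ι₁ ι₂ : Type*} [Fintype ι₁] [Fintype ι₂]
    {G : Subgroup (E ≃ₗᵢ[ℝ] E)} [Finite G] {L : AddSubgroup E} {K₁ K₂ : ℕ}
    (hG : ∀ g ∈ G, ∀ x ∈ L, g x ∈ L) (π : E →ₗ[ℝ] E)
    (hπ : ∀ g ∈ G, ∀ x, π (g x) = g (π x)) {v₁ : ι₁ → E} {v₂ : ι₂ → E} (hK₂ : 0 < K₂)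
    (h₁ : IsReducedFamily G (L ⊓ (LinearMap.ker π).toAddSubgroup) K₁ v₁)
    (h₂ : IsReducedFamily G (L.map π.toAddMonoidHom) K₂ v₂) :
    ∃ w : ι₂ → E, IsReducedFamily G L (K₁ * (Nat.card G * K₂ ^ 2)) (Sum.elim v₁ w) := by
  classical
  obtain ⟨τ, hτL, hπτ, hτ⟩ := exists_equivariant_lift hG π hπ hK₂ h₂
  have hv₁ : ∀ i, π (v₁ i) = 0 := fun i => (h₁.mem i).2
  have hc : ((Nat.card G * K₂ : ℕ) : ℝ) ≠ 0 := by
    have : 0 < Nat.card G := Nat.card_pos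
    positivity
  refine ⟨fun i => τ (v₂ i), ?_, ?_, fun x hx => ?_, fun g hg i => ?_⟩
  · rw [Fintype.linearIndependent_iff]
    intro a ha
    simp only [Fintype.sum_sum_type, Sum.elim_inl, Sum.elim_inr] at ha
    have h3 : ∀ j, a (Sum.inr j) = 0 := by
      refine Fintype.linearIndependent_iff.mp h₂.linearIndependent _ ?_
      have h4 := congrArg π ha
      simp only [map_add, map_sum, map_smul, hv₁, hπτ, smul_zero, Finset.sum_const_zero, zero_add,
        map_zero] at h4
      simp only [smul_comm _ (((Nat.card G * K₂ : ℕ) : ℝ)), ← Finset.smul_sum] at h4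
      exact (smul_eq_zero.mp h4).resolve_left hc
    simp only [h3, zero_smul, Finset.sum_const_zero, add_zero] at ha
    rintro (i | j)
    · exact Fintype.linearIndependent_iff.mp h₁.linearIndependent _ ha i
    · exact h3 j
  · rintro (i | j)
    · exact (h₁.mem i).1
    · exact hτL j
  · obtain ⟨z, hz⟩ := h₂.exponent (π x) ⟨x, hx, rfl⟩
    have hmem : ((Nat.card G * K₂ ^ 2 : ℕ) : ℝ) • x - ∑ i, (z i : ℝ) • τ (v₂ i) ∈
        L ⊓ (LinearMap.ker π).toAddSubgroup := by
      refine ⟨L.sub_mem ?_ (L.sum_mem fun i _ => ?_), ?_⟩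
      · rw [Nat.cast_smul_eq_nsmul]
        exact L.nsmul_mem hx _
      · rw [Int.cast_smul_eq_zsmul]
        exact L.zsmul_mem (hτL i) _
      · change π _ = 0
        simp only [map_sub, map_sum, map_smul, hπτ]
        simp only [smul_comm _ (((Nat.card G * K₂ : ℕ) : ℝ)), ← Finset.smul_sum, ← hz]
        rw [smul_smul, sub_eq_zero]
        push_cast
        ring_nf
    obtain ⟨y, hy⟩ := h₁.exponent _ hmem
    refine ⟨Sum.elim y fun j => K₁ * z j, ?_⟩
    simp only [Fintype.sum_sum_type, Sum.elim_inl, Sum.elim_inr, ← hy]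
    push_cast
    simp only [mul_smul, smul_sub, Finset.smul_sum]
    abel
  · rcases i with i | i
    · obtain ⟨c, hc1, hc⟩ := h₁.coord_le g hg i
      refine ⟨Sum.elim c 0, ?_, ?_⟩
      · rintro (j | j)
        · exact hc1 j
        · simp
      · simpa [Fintype.sum_sum_type] using hc
    · obtain ⟨c, hc1, hc⟩ := h₂.coord_le g hg i
      refine ⟨Sum.elim 0 c, ?_, ?_⟩
      · rintro (j | j)
        · simp
        · exact hc1 j
      · simp [Fintype.sum_sum_type, hτ g hg, hc]

variable [FiniteDimensional ℝ E]

omit [FiniteDimensional ℝ E] in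
lemma map_mem_orthogonal {U : Submodule ℝ E} {G : Subgroup (E ≃ₗᵢ[ℝ] E)}
    (hU : ∀ g ∈ G, ∀ x ∈ U, g x ∈ U) {g : E ≃ₗᵢ[ℝ] E} (hg : g ∈ G) {w : E} (hw : w ∈ Uᗮ) :
    g w ∈ Uᗮ := by
  rw [Submodule.mem_orthogonal] at hw ⊢
  intro u hu
  have h1 := hw _ (hU _ (G.inv_mem hg) u hu)
  rw [← LinearIsometryEquiv.inner_map_map g] at h1
  rwa [show g (g⁻¹ u) = u from g.apply_symm_apply u] at h1

lemma starProjection_orthogonal_comm {U : Submodule ℝ E} {G : Subgroup (E ≃ₗᵢ[ℝ] E)}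
    (hU : ∀ g ∈ G, ∀ x ∈ U, g x ∈ U) {g : E ≃ₗᵢ[ℝ] E} (hg : g ∈ G) (x : E) :
    Uᗮ.starProjection (g x) = g (Uᗮ.starProjection x) := by
  have hx : x = U.starProjection x + Uᗮ.starProjection x := by
    rw [Submodule.starProjection_orthogonal_val]
    abel
  conv_lhs => rw [hx, map_add, map_add]
  rw [(Submodule.starProjection_eq_self_iff).mpr
      (map_mem_orthogonal hU hg (Submodule.starProjection_apply_mem _ _)),
    Submodule.starProjection_orthogonal_apply_eq_zero
      (hU g hg _ (Submodule.starProjection_apply_mem _ _)), zero_add]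

lemma ker_starProjection_orthogonal (U : Submodule ℝ E) :
    LinearMap.ker (Uᗮ.starProjection : E →ₗ[ℝ] E) = U := by
  ext x
  rw [LinearMap.mem_ker]
  change Uᗮ.starProjection x = 0 ↔ _
  rw [Submodule.starProjection_apply_eq_zero_iff, Submodule.orthogonal_orthogonal]

omit [FiniteDimensional ℝ E] in
lemma IsReducedFamily.map_mem_span {ι : Type*} [Fintype ι] {G : Subgroup (E ≃ₗᵢ[ℝ] E)}
    {L : AddSubgroup E} {K : ℕ} {v : ι → E} (h : IsReducedFamily G L K v) :
    ∀ g ∈ G, ∀ x ∈ Submodule.span ℝ (Set.range v), g x ∈ Submodule.span ℝ (Set.range v) := by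
  intro g hg x hx
  induction hx using Submodule.span_induction with
  | mem x hx =>
    obtain ⟨i, rfl⟩ := hx
    obtain ⟨c, -, hc⟩ := h.coord_le g hg i
    rw [hc]
    exact Submodule.sum_mem _ fun j _ =>
      Submodule.smul_mem _ _ (Submodule.subset_span (Set.mem_range_self j))
  | zero => simp
  | add x y _ _ hx hy => rw [map_add]; exact add_mem hx hy
  | smul a x _ hx => rw [map_smul]; exact Submodule.smul_mem _ _ hx

lemma finite_map_starProjection {L : AddSubgroup E}
    (hL : ∀ R : ℝ, {x | x ∈ L ∧ ‖x‖ ≤ R}.Finite) {ι : Type*} [Fintype ι] {v : ι → E}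
    (hv : ∀ i, v i ∈ L) {U : Submodule ℝ E} (hU : U = Submodule.span ℝ (Set.range v)) (R : ℝ) :
    {y | y ∈ L.map (Uᗮ.starProjection : E →ₗ[ℝ] E).toAddMonoidHom ∧ ‖y‖ ≤ R}.Finite := by
  refine ((hL (R + ∑ i, ‖v i‖)).image Uᗮ.starProjection).subset ?_
  rintro y ⟨⟨x, hx, rfl⟩, hy⟩
  have hy : ‖Uᗮ.starProjection x‖ ≤ R := hy
  have hvU : ∀ i, v i ∈ U := fun i => hU ▸ Submodule.subset_span (Set.mem_range_self i)
  have hu : U.starProjection x ∈ Submodule.span ℝ (Set.range v) :=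
    hU ▸ Submodule.starProjection_apply_mem U x
  obtain ⟨a, ha⟩ := (Submodule.mem_span_range_iff_exists_fun ℝ).mp hu
  have hmem : ∑ i, (⌊a i⌋ : ℝ) • v i ∈ U :=
    Submodule.sum_mem _ fun i _ => Submodule.smul_mem _ _ (hvU i)
  refine ⟨x - ∑ i, (⌊a i⌋ : ℝ) • v i, ⟨L.sub_mem hx (L.sum_mem fun i _ => ?_), ?_⟩, ?_⟩
  · rw [Int.cast_smul_eq_zsmul]
    exact L.zsmul_mem (hv i) _
  · have h1 : x - ∑ i, (⌊a i⌋ : ℝ) • v i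
        = Uᗮ.starProjection x + ∑ i, Int.fract (a i) • v i := by
      rw [Submodule.starProjection_orthogonal_val, ← ha]
      simp only [Int.fract, sub_smul, Finset.sum_sub_distrib]
      abel
    rw [h1]
    refine (norm_add_le _ _).trans ?_
    refine add_le_add hy ((norm_sum_le _ _).trans (Finset.sum_le_sum fun i _ => ?_))
    rw [norm_smul, Real.norm_eq_abs, abs_of_nonneg (Int.fract_nonneg _)]
    exact mul_le_of_le_one_left (norm_nonneg _) (Int.fract_lt_one _).le
  · rw [map_sub, Submodule.starProjection_orthogonal_apply_eq_zero hmem, sub_zero]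
    rfl

lemma map_mem_map_starProjection {L : AddSubgroup E} {U : Submodule ℝ E}
    {G : Subgroup (E ≃ₗᵢ[ℝ] E)} (hU : ∀ g ∈ G, ∀ x ∈ U, g x ∈ U)
    (hG : ∀ g ∈ G, ∀ x ∈ L, g x ∈ L) :
    ∀ g ∈ G, ∀ y ∈ L.map (Uᗮ.starProjection : E →ₗ[ℝ] E).toAddMonoidHom,
      g y ∈ L.map (Uᗮ.starProjection : E →ₗ[ℝ] E).toAddMonoidHom := by
  rintro g hg _ ⟨x, hx, rfl⟩
  exact ⟨g x, hG g hg x hx, starProjection_orthogonal_comm hU hg x⟩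

variable (E) in
/-- A finite group of linear isometries preserving a discrete subgroup has a reduced family there,
of exponent bounded in terms of the order of the group and the dimension. -/
lemma exists_isReducedFamily {c : ℕ} (hc : 0 < c) (d : ℕ) :
    ∃ K : ℕ, 0 < K ∧ ∀ (G : Subgroup (E ≃ₗᵢ[ℝ] E)) (L : AddSubgroup E), Finite G →
      Nat.card G ∣ c → (∀ R : ℝ, {x | x ∈ L ∧ ‖x‖ ≤ R}.Finite) → (∀ g ∈ G, ∀ x ∈ L, g x ∈ L) →
      Module.finrank ℝ (Submodule.span ℝ (L : Set E)) ≤ d →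
      ∃ (r : ℕ) (v : Fin r → E), IsReducedFamily G L K v := by
  have hbot : ∀ (G : Subgroup (E ≃ₗᵢ[ℝ] E)) (L : AddSubgroup E) (K : ℕ), L = ⊥ →
      ∃ (r : ℕ) (v : Fin r → E), IsReducedFamily G L K v := by
    rintro G L K rfl
    exact ⟨0, Fin.elim0, linearIndependent_empty_type, fun i => i.elim0, fun x hx =>
      ⟨Fin.elim0, by simp [(AddSubgroup.mem_bot.mp hx)]⟩, fun g _ i => i.elim0⟩
  induction d with
  | zero =>
    refine ⟨1, one_pos, fun G L _ _ _ _ hd => hbot G L 1 ?_⟩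
    rw [Nat.le_zero, Submodule.finrank_eq_zero, Submodule.span_eq_bot] at hd
    rwa [AddSubgroup.eq_bot_iff_forall]
  | succ d ih =>
    obtain ⟨K, hK, ih⟩ := ih
    refine ⟨(Module.finrank ℝ E ^ Module.finrank ℝ E).factorial * (c * K ^ 2),
      Nat.mul_pos (Nat.factorial_pos _) (by positivity), fun G L hfin hcard hL hG hd => ?_⟩
    by_cases hL0 : L = ⊥
    · exact hbot G L _ hL0
    obtain ⟨r, v, hr, hv⟩ := exists_isReducedFamily_minimal hL hG hL0
    set U := Submodule.span ℝ (Set.range v) with hU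
    have hlt : Module.finrank ℝ (Submodule.span ℝ
        (L.map (Uᗮ.starProjection : E →ₗ[ℝ] E).toAddMonoidHom : Set E)) ≤ d := by
      refine Nat.lt_succ_iff.mp ((Submodule.finrank_lt_finrank_of_lt ?_).trans_le hd)
      have hUL : U ≤ Submodule.span ℝ (L : Set E) := by
        rw [hU, Submodule.span_le]
        rintro _ ⟨i, rfl⟩
        exact Submodule.subset_span (hv.mem i).1
      have hle : Submodule.span ℝ
          (L.map (Uᗮ.starProjection : E →ₗ[ℝ] E).toAddMonoidHom : Set E)
          ≤ Submodule.span ℝ (L : Set E) ⊓ Uᗮ := by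
        rw [Submodule.span_le]
        rintro _ ⟨x, hx, rfl⟩
        refine ⟨?_, Submodule.starProjection_apply_mem _ _⟩
        change Uᗮ.starProjection x ∈ _
        rw [Submodule.starProjection_orthogonal_val]
        exact Submodule.sub_mem _ (Submodule.subset_span hx)
          (hUL (Submodule.starProjection_apply_mem _ _))
      refine lt_of_le_of_ne (hle.trans inf_le_left) fun heq => ?_
      have h1 : v ⟨0, hr⟩ ∈ Uᗮ :=
        (hle (heq ▸ Submodule.subset_span (hv.mem ⟨0, hr⟩).1)).2
      have h2 : v ⟨0, hr⟩ ∈ U := (hv.mem ⟨0, hr⟩).2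
      exact hv.linearIndependent.ne_zero _
        (inner_self_eq_zero.mp (Submodule.inner_right_of_mem_orthogonal h2 h1))
    obtain ⟨s, w, hw⟩ := ih G (L.map (Uᗮ.starProjection : E →ₗ[ℝ] E).toAddMonoidHom) hfin hcard
      (finite_map_starProjection hL (fun i => (hv.mem i).1) hU)
      (map_mem_map_starProjection hv.map_mem_span hG) hlt
    obtain ⟨u, hu⟩ := IsReducedFamily.exists_glue hG (Uᗮ.starProjection : E →ₗ[ℝ] E)
      (fun g hg => starProjection_orthogonal_comm hv.map_mem_span hg) hK
      (by rwa [ker_starProjection_orthogonal]) hw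
    exact ⟨r + s, _, (hu.reindex finSumFinEquiv.symm).of_dvd
      (mul_dvd_mul_left _ (mul_dvd_mul_right hcard _))⟩

variable (E) in
/-- The reduced family can be chosen to extend one of a given rational invariant subspace. -/
lemma exists_isReducedFamily_adapted {c : ℕ} (hc : 0 < c) :
    ∃ K : ℕ, 0 < K ∧ ∀ (G : Subgroup (E ≃ₗᵢ[ℝ] E)) (L : AddSubgroup E) (V : Submodule ℝ E),
      Finite G → Nat.card G ∣ c → (∀ R : ℝ, {x | x ∈ L ∧ ‖x‖ ≤ R}.Finite) →
      (∀ g ∈ G, ∀ x ∈ L, g x ∈ L) → (∀ g ∈ G, ∀ x ∈ V, g x ∈ V) →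
      V ≤ Submodule.span ℝ ((L : Set E) ∩ V) →
      ∃ (r s : ℕ) (v : Fin r → E) (w : Fin s → E), IsReducedFamily G L K (Sum.elim v w) ∧
        Submodule.span ℝ (Set.range v) = V := by
  obtain ⟨K, hK, h⟩ := exists_isReducedFamily E hc (Module.finrank ℝ E)
  refine ⟨K * (c * K ^ 2), by positivity, fun G L V hfin hcard hL hG hGV hV => ?_⟩
  obtain ⟨r, v, hv⟩ := h G (L ⊓ V.toAddSubgroup) hfin hcard
    (fun R => (hL R).subset fun x hx => ⟨hx.1.1, hx.2⟩)
    (fun g hg x hx => ⟨hG g hg x hx.1, hGV g hg x hx.2⟩) (Submodule.finrank_le _)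
  have hspan : Submodule.span ℝ (Set.range v) = V := by
    refine le_antisymm (Submodule.span_le.mpr ?_) (hV.trans (Submodule.span_le.mpr ?_))
    · rintro _ ⟨i, rfl⟩
      exact (hv.mem i).2
    · exact hv.subset_span hK
  obtain ⟨s, w, hw⟩ := h G (L.map (Vᗮ.starProjection : E →ₗ[ℝ] E).toAddMonoidHom) hfin hcard
    (finite_map_starProjection hL (fun i => (hv.mem i).1) hspan.symm)
    (map_mem_map_starProjection hGV hG) (Submodule.finrank_le _)
  obtain ⟨u, hu⟩ := IsReducedFamily.exists_glue hG (Vᗮ.starProjection : E →ₗ[ℝ] E)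
    (fun g hg => starProjection_orthogonal_comm hGV hg) hK
    (by rwa [ker_starProjection_orthogonal]) hw
  exact ⟨r, s, v, u, hu.of_dvd (mul_dvd_mul_left _ (mul_dvd_mul_right hcard _)), hspan⟩

end Glue

section Frame

variable {E : Type*} [NormedAddCommGroup E] [InnerProductSpace ℝ E]

/-- An isometry congruent to the identity modulo `3` on a full lattice is the identity. -/
lemma eq_one_of_sub_mem_three_nsmul {A : E ≃ₗᵢ[ℝ] E} {L : AddSubgroup E}
    (hL : ∀ R : ℝ, {x | x ∈ L ∧ ‖x‖ ≤ R}.Finite) (hspan : Submodule.span ℝ (L : Set E) = ⊤)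
    (hA : ∀ x ∈ L, ∃ y ∈ L, A x - x = (3 : ℝ) • y) : A = 1 := by
  have hfix : ∀ t ∈ L, A t = t := by
    intro t ht
    refine fixes_of_contraction hL ((1 / 3 : ℝ) • (A.toLinearEquiv.toLinearMap - LinearMap.id))
      (c := 3) (r := 2 / 3) (by norm_num) (fun x => ?_) (fun x hx => ?_) (by norm_num)
      (by norm_num) (fun x => ?_) ht
    · simp [smul_smul]
    · obtain ⟨y, hy, hxy⟩ := hA x hx
      have : ((1 / 3 : ℝ) • (A.toLinearEquiv.toLinearMap - LinearMap.id) : E →ₗ[ℝ] E) x = y := by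
        change (1 / 3 : ℝ) • (A x - x) = y
        rw [hxy, smul_smul]
        norm_num
      rwa [this]
    · change ‖(1 / 3 : ℝ) • (A x - x)‖ ≤ _
      rw [norm_smul, Real.norm_of_nonneg (by norm_num)]
      have := norm_sub_le (A x) x
      rw [LinearIsometryEquiv.norm_map] at this
      linarith
  have h1 : A.toLinearEquiv.toLinearMap = LinearMap.id :=
    LinearMap.ext_on (s := (L : Set E)) hspan fun t ht => hfix t ht
  ext x
  exact LinearMap.congr_fun h1 x

variable (E) in
/-- Minkowski's bound: the groups of linear isometries preserving a full lattice are finite, of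
bounded order. -/
lemma exists_natCard_le_of_lattice [FiniteDimensional ℝ E] :
    ∃ C : ℕ, ∀ (G : Subgroup (E ≃ₗᵢ[ℝ] E)) (L : AddSubgroup E),
      (∀ R : ℝ, {x | x ∈ L ∧ ‖x‖ ≤ R}.Finite) → Submodule.span ℝ (L : Set E) = ⊤ →
      (∀ g ∈ G, ∀ x ∈ L, g x ∈ L) → Finite G ∧ Nat.card G ≤ C := by
  obtain ⟨K, hK, h⟩ := exists_isReducedFamily E one_pos (Module.finrank ℝ E)
  have hK' : (K : ℝ) ≠ 0 := by exact_mod_cast hK.ne'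
  set M := 3 * K ^ 2 with hM
  have hM0 : 0 < M := by positivity
  have : NeZero M := ⟨hM0.ne'⟩
  refine ⟨(M ^ Module.finrank ℝ E) ^ Module.finrank ℝ E, fun G L hL hspan hG => ?_⟩
  obtain ⟨r, v, hv⟩ := h ⊥ L inferInstance (by simp) hL
    (fun g hg x hx => by rw [Subgroup.mem_bot.mp hg]; exact hx) (Submodule.finrank_le _)
  have hr : r ≤ Module.finrank ℝ E := by
    simpa using hv.linearIndependent.fintype_card_le_finrank
  choose z hz using fun (g : G) i => hv.exponent _ (hG g g.2 _ (hv.mem i))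
  let f : G → Fin r → Fin r → ZMod M := fun g i j => z g i j
  have hf : Function.Injective f := by
    intro g k hgk
    have hdiv : ∀ i j, ∃ y : ℤ, z g i j - z k i j = M * y := by
      intro i j
      have h1 : ((z g i j : ℤ) : ZMod M) = (z k i j : ℤ) := congrFun (congrFun hgk i) j
      rw [← sub_eq_zero, ← Int.cast_sub, ZMod.intCast_zmod_eq_zero_iff_dvd] at h1
      exact h1
    choose y hy using hdiv
    let t : Fin r → E := fun i => ∑ j, (y i j : ℝ) • v j
    have ht : ∀ i, t i ∈ L := fun i => L.sum_mem fun j _ => by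
      rw [Int.cast_smul_eq_zsmul]
      exact L.zsmul_mem (hv.mem j) _
    have hgv : ∀ i, (g : E ≃ₗᵢ[ℝ] E) (v i) - (k : E ≃ₗᵢ[ℝ] E) (v i) = (3 * K : ℝ) • t i := by
      intro i
      refine smul_right_injective E hK' ?_
      change (K : ℝ) • (_ - _) = (K : ℝ) • _
      rw [smul_sub, hz, hz, ← Finset.sum_sub_distrib, smul_smul, Finset.smul_sum]
      refine Finset.sum_congr rfl fun j _ => ?_
      rw [← sub_smul, ← Int.cast_sub, hy, smul_smul, hM]
      push_cast
      ring_nf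
    have hgx : ∀ x ∈ L, ∃ s ∈ L, (g : E ≃ₗᵢ[ℝ] E) x - (k : E ≃ₗᵢ[ℝ] E) x = (3 : ℝ) • s := by
      intro x hx
      obtain ⟨a, ha⟩ := hv.exponent x hx
      refine ⟨∑ i, (a i : ℝ) • t i, L.sum_mem fun i _ => ?_, ?_⟩
      · rw [Int.cast_smul_eq_zsmul]
        exact L.zsmul_mem (ht i) _
      · refine smul_right_injective E hK' ?_
        change (K : ℝ) • (_ - _) = (K : ℝ) • _
        rw [smul_sub, ← map_smul, ← map_smul, ha, map_sum, map_sum, ← Finset.sum_sub_distrib,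
          smul_smul, Finset.smul_sum]
        refine Finset.sum_congr rfl fun i _ => ?_
        rw [map_smul, map_smul, ← smul_sub, hgv, smul_smul, smul_smul]
        ring_nf
    have h1 : (k : E ≃ₗᵢ[ℝ] E)⁻¹ * g = 1 := by
      refine eq_one_of_sub_mem_three_nsmul hL hspan fun x hx => ?_
      obtain ⟨s, hs, hxs⟩ := hgx x hx
      refine ⟨(k : E ≃ₗᵢ[ℝ] E)⁻¹ s, hG _ (G.inv_mem k.2) _ hs, ?_⟩
      have h2 := congrArg (⇑((k : E ≃ₗᵢ[ℝ] E)⁻¹)) hxs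
      rw [map_sub, map_smul] at h2
      refine Eq.trans (congrArg _ ?_) h2
      exact ((k : E ≃ₗᵢ[ℝ] E).symm_apply_apply x).symm
    exact Subtype.ext (inv_mul_eq_one.mp h1).symm
  have : Finite G := Finite.of_injective f hf
  refine ⟨this, (Nat.card_le_card_of_injective f hf).trans ?_⟩
  rw [Nat.card_eq_fintype_card, Fintype.card_fun, Fintype.card_fun, ZMod.card, Fintype.card_fin]
  exact (Nat.pow_le_pow_left (Nat.pow_le_pow_right hM0 hr) _).trans
    (Nat.pow_le_pow_right (Nat.pow_pos hM0) hr)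

/-- An average of orbit points is moved by `Γ` by rational lattice vectors. -/
lemma exists_card_smul_sub_mem (Γ : Subgroup (E ≃ᵢ E)) [Finite (Γ.map linearPart)] :
    ∃ p : E, ∀ γ ∈ Γ,
      ((Nat.card (Γ.map linearPart) : ℕ) : ℝ) • (γ p - p) ∈ translationLattice Γ := by
  classical
  have := Fintype.ofFinite (Γ.map linearPart)
  choose δ hδΓ hδ using fun g : Γ.map linearPart => g.2
  have hc : ((Nat.card (Γ.map linearPart) : ℕ) : ℝ) ≠ 0 := by exact_mod_cast Nat.card_pos.ne'
  set c : ℝ := ((Nat.card (Γ.map linearPart) : ℕ) : ℝ) with hc_def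
  refine ⟨c⁻¹ • ∑ g, δ g 0, fun γ hγ => ?_⟩
  let a : Γ.map linearPart := ⟨linearPart γ, γ, hγ, rfl⟩
  have h1 : c • (γ (c⁻¹ • ∑ g, δ g 0) - c⁻¹ • ∑ g, δ g 0) = ∑ g, ((γ * δ g) 0 - δ (a * g) 0) := by
    rw [isometryEquiv_apply γ, Finset.sum_sub_distrib,
      Fintype.sum_equiv (Equiv.mulLeft a) (fun g => δ (a * g) 0) (fun g => δ g 0) fun _ => rfl]
    simp only [IsometryEquiv.mul_apply, isometryEquiv_apply γ (δ _ 0), Finset.sum_add_distrib]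
    rw [smul_sub, smul_add, map_smul, smul_inv_smul₀ hc, smul_inv_smul₀ hc, map_sum,
      Finset.sum_const, Finset.card_univ, ← Nat.card_eq_fintype_card, ← Nat.cast_smul_eq_nsmul ℝ]
  rw [h1]
  refine AddSubgroup.sum_mem _ fun g _ =>
    sub_mem_translationLattice (Γ.mul_mem hγ (hδΓ g)) (hδΓ _) ?_
  rw [map_mul, hδ, hδ]
  rfl

end Frame

section Classification

variable {E : Type*} [NormedAddCommGroup E] [InnerProductSpace ℝ E]

lemma linearPart_mem_spanOf {Γ N : Subgroup (E ≃ᵢ E)} (hN : IsCompleteNormal Γ N) :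
    ∀ g ∈ Γ.map linearPart, ∀ x ∈ spanOf N, g x ∈ spanOf N := by
  rintro _ ⟨γ, hγ, rfl⟩ x hx
  induction hx using Submodule.span_induction with
  | mem x hx =>
    refine Submodule.subset_span ?_
    change transIso _ ∈ N
    rw [← conj_transIso_s17]
    exact hN.2.1 γ hγ _ hx
  | zero => simp
  | add x y _ _ hx hy => rw [map_add]; exact add_mem hx hy
  | smul a x _ hx => rw [map_smul]; exact Submodule.smul_mem _ _ hx

/-- A complete normal subgroup consists of the elements moving all points along its span. -/
lemma IsCompleteNormal.mem_iff [FiniteDimensional ℝ E] {Γ N : Subgroup (E ≃ᵢ E)}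
    (hN : IsCompleteNormal Γ N) {γ : E ≃ᵢ E} (hγ : γ ∈ Γ) :
    γ ∈ N ↔ ∀ x, γ x - x ∈ spanOf N := by
  have hinv := linearPart_mem_spanOf hN
  have hγ' : linearPart γ ∈ Γ.map linearPart := ⟨γ, hγ, rfl⟩
  rw [hN.2.2 γ hγ (γ 0) (linearPart γ) fun x => by rw [isometryEquiv_apply γ x, add_comm]]
  constructor
  · rintro ⟨h0, hfix⟩ x
    have hx : x = (spanOf N).starProjection x + (spanOf N)ᗮ.starProjection x := by
      rw [Submodule.starProjection_orthogonal_val]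
      abel
    have h1 : γ x - x = linearPart γ ((spanOf N).starProjection x)
        - (spanOf N).starProjection x + γ 0 := by
      rw [isometryEquiv_apply γ x]
      nth_rewrite 1 2 [hx]
      rw [map_add, hfix _ (Submodule.starProjection_apply_mem _ _)]
      abel
    rw [h1]
    exact add_mem (sub_mem (hinv _ hγ' _ (Submodule.starProjection_apply_mem _ _))
      (Submodule.starProjection_apply_mem _ _)) h0
  · intro h
    refine ⟨by simpa using h 0, fun w hw => ?_⟩
    have h1 : linearPart γ w - w ∈ spanOf N := by
      have h2 := sub_mem (h w) (h 0)
      rw [isometryEquiv_apply γ w] at h2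
      convert h2 using 1
      abel
    have h3 : linearPart γ w - w ∈ (spanOf N)ᗮ :=
      sub_mem (map_mem_orthogonal hinv hγ' hw) hw
    exact sub_eq_zero.mp
      (inner_self_eq_zero.mp (Submodule.inner_right_of_mem_orthogonal h1 h3))

variable {ι : Type*} [Fintype ι]

/-- The element `γ` is described in the frame with base point `p` and basis `b` by the integral
vector `z` and the integral matrix `Z`, up to the denominator `K`. -/
def HasCoords (K : ℕ) (p : E) (b : Module.Basis ι ℝ E) (γ : E ≃ᵢ E) (z : ι → ℤ)
    (Z : ι → ι → ℤ) : Prop :=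
  (K : ℝ) • (γ p - p) = ∑ i, (z i : ℝ) • b i ∧
    ∀ i, (K : ℝ) • linearPart γ (b i) = ∑ j, (Z i j : ℝ) • b j

/-- A frame of lattice vectors in which `Γ` has coordinates with denominator `K` and bounded
matrices, and in which `V` is a coordinate subspace. -/
structure IsFrame (Γ : Subgroup (E ≃ᵢ E)) (V : Submodule ℝ E) (K : ℕ) (p : E)
    (b : Module.Basis ι ℝ E) (I : Set ι) : Prop where
  mem : ∀ i, b i ∈ translationLattice Γ
  exists_coords : ∀ γ ∈ Γ, ∃ z Z, HasCoords K p b γ z Z ∧ ∀ i j, |Z i j| ≤ K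
  span_image : Submodule.span ℝ (Set.image b I) = V

/-- The coordinates of the elements of `Γ`, with bounded entries. -/
def coordSet (Γ : Subgroup (E ≃ᵢ E)) (K : ℕ) (p : E) (b : Module.Basis ι ℝ E) :
    Set ((ι → ℤ) × (ι → ι → ℤ)) :=
  {q | ((∀ i, 0 ≤ q.1 i ∧ q.1 i < K) ∧ ∀ i j, |q.2 i j| ≤ K) ∧ ∃ γ ∈ Γ, HasCoords K p b γ q.1 q.2}

lemma HasCoords.transIso_mul {K : ℕ} {p : E} {b : Module.Basis ι ℝ E} {γ : E ≃ᵢ E} {z : ι → ℤ}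
    {Z : ι → ι → ℤ} (h : HasCoords K p b γ z Z) (y : ι → ℤ) :
    HasCoords K p b (transIso (∑ i, (y i : ℝ) • b i) * γ) (fun i => K * y i + z i) Z := by
  refine ⟨?_, fun i => ?_⟩
  · rw [IsometryEquiv.mul_apply, transIso_apply, add_sub_assoc, smul_add, h.1, Finset.smul_sum,
      ← Finset.sum_add_distrib]
    refine Finset.sum_congr rfl fun i _ => ?_
    push_cast
    rw [add_smul, mul_smul]
  · rw [map_mul, linearPart_transIso, one_mul]
    exact h.2 i

variable {Γ Γ' : Subgroup (E ≃ᵢ E)} {V V' : Submodule ℝ E} {K : ℕ} {p p' : E}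
  {b b' : Module.Basis ι ℝ E} {I : Set ι}

lemma IsFrame.transIso_mem (h : IsFrame Γ V K p b I) (y : ι → ℤ) :
    transIso (∑ i, (y i : ℝ) • b i) ∈ Γ := by
  refine AddSubgroup.sum_mem (translationLattice Γ) fun i _ => ?_
  rw [Int.cast_smul_eq_zsmul]
  exact AddSubgroup.zsmul_mem _ (h.mem i) _

lemma IsFrame.exists_hasCoords (hK : 0 < K) (h : IsFrame Γ V K p b I)
    (h' : IsFrame Γ' V' K p' b' I) (hcoord : coordSet Γ K p b ⊆ coordSet Γ' K p' b')
    {γ : E ≃ᵢ E} (hγ : γ ∈ Γ) :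
    ∃ γ' ∈ Γ', ∃ z Z, HasCoords K p b γ z Z ∧ HasCoords K p' b' γ' z Z := by
  obtain ⟨z, Z, hz, hZ⟩ := h.exists_coords γ hγ
  have hK' : (0 : ℤ) < K := by exact_mod_cast hK
  have hmem : ((fun i => z i % K, Z) : (ι → ℤ) × (ι → ι → ℤ)) ∈ coordSet Γ K p b := by
    refine ⟨⟨fun i => ⟨Int.emod_nonneg _ hK'.ne', Int.emod_lt_of_pos _ hK'⟩, hZ⟩, _,
      Γ.mul_mem (h.transIso_mem fun i => -(z i / K)) hγ, ?_⟩
    convert hz.transIso_mul (fun i => -(z i / K)) using 2 with i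
    change z i % K = _
    rw [Int.emod_def]
    ring
  obtain ⟨-, δ, hδ, hzδ⟩ := hcoord hmem
  refine ⟨_, Γ'.mul_mem (h'.transIso_mem fun i => z i / K) hδ, z, Z, hz, ?_⟩
  convert hzδ.transIso_mul (fun i => z i / K) using 2 with i
  exact (Int.mul_ediv_add_emod (z i) K).symm

/-- The affine map carrying one frame to another. -/
def frameMap (p p' : E) (b b' : Module.Basis ι ℝ E) : E ≃ E :=
  (Equiv.subRight p).trans ((b.equiv b' (Equiv.refl ι)).toEquiv.trans (Equiv.addRight p'))

omit [Fintype ι] in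
lemma frameMap_apply (x : E) :
    frameMap p p' b b' x = b.equiv b' (Equiv.refl ι) (x - p) + p' := rfl

omit [Fintype ι] in
lemma frameMap_sub (x y : E) :
    frameMap p p' b b' x - frameMap p p' b b' y = b.equiv b' (Equiv.refl ι) (x - y) := by
  rw [frameMap_apply, frameMap_apply, add_sub_add_right_eq_sub, ← map_sub, sub_sub_sub_cancel_right]

lemma HasCoords.frameMap_comm (hK : 0 < K) {γ γ' : E ≃ᵢ E} {z : ι → ℤ} {Z : ι → ι → ℤ}
    (h : HasCoords K p b γ z Z) (h' : HasCoords K p' b' γ' z Z) (x : E) :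
    frameMap p p' b b' (γ x) = γ' (frameMap p p' b b' x) := by
  set e := b.equiv b' (Equiv.refl ι) with he
  have hK' : (K : ℝ) ≠ 0 := by exact_mod_cast hK.ne'
  have heb : ∀ i, e (b i) = b' i := fun i => by simp [he]
  have h0 : e (γ p - p) = γ' p' - p' := by
    refine smul_right_injective E hK' ?_
    change (K : ℝ) • _ = (K : ℝ) • _
    rw [← map_smul, h.1, h'.1, map_sum]
    simp only [map_smul, heb]
  have hlin : e.toLinearMap ∘ₗ (linearPart γ).toLinearEquiv.toLinearMap
      = (linearPart γ').toLinearEquiv.toLinearMap ∘ₗ e.toLinearMap := by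
    refine b.ext fun i => smul_right_injective E hK' ?_
    change (K : ℝ) • e (linearPart γ (b i)) = (K : ℝ) • linearPart γ' (e (b i))
    rw [← map_smul, h.2, heb, h'.2, map_sum]
    simp only [map_smul, heb]
  have hlin' : e (linearPart γ (x - p)) = linearPart γ' (e (x - p)) :=
    LinearMap.congr_fun hlin (x - p)
  have h1 : γ x - p = linearPart γ (x - p) + (γ p - p) := by
    rw [← isometryEquiv_sub]
    abel
  have h2 : γ' (e (x - p) + p') = linearPart γ' (e (x - p)) + γ' p' := by
    rw [← sub_eq_iff_eq_add, isometryEquiv_sub, add_sub_cancel_right]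
  rw [frameMap_apply, frameMap_apply, h1, map_add, h0, hlin', h2]
  abel

lemma IsFrame.map_equiv (h : IsFrame Γ V K p b I) (h' : IsFrame Γ' V' K p' b' I) (x : E) :
    b.equiv b' (Equiv.refl ι) x ∈ V' ↔ x ∈ V := by
  have h1 : V' = V.map (b.equiv b' (Equiv.refl ι)).toLinearMap := by
    rw [← h.span_image, ← h'.span_image, Submodule.map_span, ← Set.image_comp]
    congr 1
    exact Set.image_congr fun i _ => by simp
  rw [h1]
  exact (b.equiv b' (Equiv.refl ι)).injective.mem_set_image

omit [InnerProductSpace ℝ E] in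
lemma exists_mulEquiv_of_conj (φ : E ≃ E)
    (h : ∀ γ ∈ Γ, ∃ γ' ∈ Γ', ∀ x, φ (γ x) = γ' (φ x))
    (h' : ∀ γ' ∈ Γ', ∃ γ ∈ Γ, ∀ x, φ (γ x) = γ' (φ x)) :
    ∃ ζ : Γ ≃* Γ', ∀ (γ : Γ) x, φ ((γ : E ≃ᵢ E) x) = (ζ γ : E ≃ᵢ E) (φ x) := by
  choose f hfΓ hf using fun γ : Γ => h γ γ.2
  have huniq : ∀ {γ₁ γ₂ : E ≃ᵢ E}, (∀ x, γ₁ (φ x) = γ₂ (φ x)) → γ₁ = γ₂ := fun H => by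
    ext x
    simpa using H (φ.symm x)
  let F : Γ →* Γ' := MonoidHom.mk' (fun γ => ⟨f γ, hfΓ γ⟩) fun γ δ => by
    refine Subtype.ext (huniq fun x => ?_)
    rw [← hf]
    change φ ((γ : E ≃ᵢ E) ((δ : E ≃ᵢ E) x)) = f γ (f δ (φ x))
    rw [hf, hf]
  refine ⟨MulEquiv.ofBijective F ⟨fun γ δ hγδ => ?_, fun γ' => ?_⟩, hf⟩
  · ext x
    refine φ.injective ?_
    rw [hf, hf, show f γ = f δ from congrArg Subtype.val hγδ]
  · obtain ⟨γ, hγ, hx⟩ := h' γ' γ'.2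
    exact ⟨⟨γ, hγ⟩, Subtype.ext (huniq fun x => by rw [← hx]; exact (hf ⟨γ, hγ⟩ x).symm)⟩

/-- Pairs with frames having the same coordinates are isomorphic. -/
lemma IsFrame.exists_mulEquiv [FiniteDimensional ℝ E] {N N' : Subgroup (E ≃ᵢ E)} (hK : 0 < K)
    (hN : IsCompleteNormal Γ N) (hN' : IsCompleteNormal Γ' N')
    (h : IsFrame Γ (spanOf N) K p b I) (h' : IsFrame Γ' (spanOf N') K p' b' I)
    (hcoord : coordSet Γ K p b = coordSet Γ' K p' b') :
    ∃ ζ : Γ ≃* Γ', ∀ x : Γ, (x : E ≃ᵢ E) ∈ N ↔ (ζ x : E ≃ᵢ E) ∈ N' := by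
  obtain ⟨ζ, hζ⟩ := exists_mulEquiv_of_conj (Γ := Γ) (Γ' := Γ') (frameMap p p' b b')
    (fun γ hγ => by
      obtain ⟨γ', hγ', z, Z, h1, h2⟩ := h.exists_hasCoords hK h' hcoord.le hγ
      exact ⟨γ', hγ', h1.frameMap_comm hK h2⟩)
    (fun γ' hγ' => by
      obtain ⟨γ, hγ, z, Z, h1, h2⟩ := h'.exists_hasCoords hK h hcoord.ge hγ'
      exact ⟨γ, hγ, h2.frameMap_comm hK h1⟩)
  refine ⟨ζ, fun γ => ?_⟩
  rw [hN.mem_iff γ.2, hN'.mem_iff (ζ γ).2]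
  refine (frameMap p p' b b').forall_congr fun {x} => ?_
  rw [← hζ, frameMap_sub, h.map_equiv h']

variable (E) in
/-- Every complete normal subgroup of a space group has a frame, with a denominator depending only
on the dimension. -/
lemma exists_isFrame [FiniteDimensional ℝ E] (e : Fin (Module.finrank ℝ E) ≃ ι) :
    ∃ K : ℕ, 0 < K ∧ ∀ Γ N : Subgroup (E ≃ᵢ E), IsSpaceGroup Γ → IsCompleteNormal Γ N →
      ∃ (p : E) (b : Module.Basis ι ℝ E) (I : Set ι), IsFrame Γ (spanOf N) K p b I := by
  obtain ⟨C, hC⟩ := exists_natCard_le_of_lattice E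
  obtain ⟨K, hK, h⟩ := exists_isReducedFamily_adapted E C.factorial_pos
  refine ⟨K * C.factorial, Nat.mul_pos hK C.factorial_pos, fun Γ N hΓ hN => ?_⟩
  have hL := finite_translationLattice hΓ.finite_norm_le
  have hG : ∀ g ∈ Γ.map linearPart, ∀ x ∈ translationLattice Γ, g x ∈ translationLattice Γ := by
    rintro _ ⟨γ, hγ, rfl⟩ x hx
    exact linearPart_mem_translationLattice hγ hx
  obtain ⟨hfin, hcard⟩ := hC (Γ.map linearPart) _ hL hΓ.span_translationLattice hG
  have hdvd : Nat.card (Γ.map linearPart) ∣ C.factorial := Nat.dvd_factorial Nat.card_pos hcard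
  obtain ⟨r, s, v, w, hvw, hspan⟩ := h (Γ.map linearPart) _ (spanOf N) hfin hdvd hL hG
    (linearPart_mem_spanOf hN)
    (Submodule.span_mono fun x hx => ⟨hN.1 hx, Submodule.subset_span hx⟩)
  obtain ⟨p, hp⟩ := exists_card_smul_sub_mem Γ
  have htop : ⊤ ≤ Submodule.span ℝ (Set.range (Sum.elim v w)) := by
    rw [← hΓ.span_translationLattice, Submodule.span_le]
    exact hvw.subset_span hK
  let b₀ := Module.Basis.mk hvw.linearIndependent htop
  let ε : Fin r ⊕ Fin s ≃ ι := (Fintype.equivFinOfCardEq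
    (Module.finrank_eq_card_basis b₀).symm).trans e
  let b := b₀.reindex ε
  have hb : ∀ i, b i = (Sum.elim v w ∘ ε.symm) i := fun i => by simp [b, b₀]
  have hred : IsReducedFamily (Γ.map linearPart) (translationLattice Γ) K b := by
    rw [show (b : ι → E) = Sum.elim v w ∘ ε.symm from funext hb]
    exact hvw.reindex ε.symm
  refine ⟨p, b, Set.range (ε ∘ Sum.inl), hred.mem, fun γ hγ => ?_, ?_⟩
  · have hγ' : linearPart γ ∈ Γ.map linearPart := ⟨γ, hγ, rfl⟩
    obtain ⟨m, hm⟩ := hdvd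
    obtain ⟨z, hz⟩ := hred.exponent _ (AddSubgroup.nsmul_mem _ (hp γ hγ) m)
    choose Z hZ using fun i => hred.exponent _ (hG _ hγ' _ (hred.mem i))
    choose c hc1 hc using hred.coord_le _ hγ'
    have hZc : ∀ i j, (Z i j : ℝ) = K * c i j := by
      intro i j
      have h1 : ∑ j, ((Z i j : ℝ) - K * c i j) • b j = 0 := by
        simp only [sub_smul, mul_smul, Finset.sum_sub_distrib, ← Finset.smul_sum]
        rw [← hZ, ← hc, sub_self]
      exact sub_eq_zero.mp (Fintype.linearIndependent_iff.mp b.linearIndependent _ h1 j)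
    refine ⟨z, fun i j => C.factorial * Z i j, ⟨?_, fun i => ?_⟩, fun i j => ?_⟩
    · rw [← hz, hm, ← Nat.cast_smul_eq_nsmul ℝ, smul_smul, smul_smul]
      push_cast
      ring_nf
    · rw [mul_comm K, Nat.cast_mul, mul_smul, hZ, Finset.smul_sum]
      refine Finset.sum_congr rfl fun j _ => ?_
      push_cast
      rw [mul_smul]
    · have h1 : |(Z i j : ℝ)| ≤ K := by
        rw [hZc, abs_mul, Nat.abs_cast]
        exact mul_le_of_le_one_right (Nat.cast_nonneg _) (hc1 i j)
      have h2 : |Z i j| ≤ K := by exact_mod_cast h1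
      rw [abs_mul, Nat.abs_cast, mul_comm]
      push_cast
      gcongr
  · rw [← hspan, ← Set.range_comp]
    congr 2
    ext i
    simp [hb]

end Classification

lemma finite_bounded_coords {ι : Type*} [Finite ι] (K : ℕ) :
    {q : (ι → ℤ) × (ι → ι → ℤ) |
      (∀ i, 0 ≤ q.1 i ∧ q.1 i < K) ∧ ∀ i j, |q.2 i j| ≤ K}.Finite := by
  refine ((Set.Finite.pi' fun _ : ι => Set.finite_Ico (0 : ℤ) K).prod
    (Set.Finite.pi' fun _ : ι => Set.Finite.pi' fun _ : ι => Set.finite_Icc (-(K : ℤ)) K)).subset ?_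
  rintro q ⟨h1, h2⟩
  exact ⟨h1, fun i j => abs_le.mp (h2 i j)⟩

lemma exists_finite_representatives {α β : Type*} {f : α → β} (hf : (Set.range f).Finite) :
    ∃ S : Set α, S.Finite ∧ ∀ a, ∃ s ∈ S, f s = f a := by
  choose g hg using fun y : Set.range f => y.2
  have := hf.to_subtype
  exact ⟨Set.range g, Set.finite_range g, fun a => ⟨g ⟨f a, a, rfl⟩, ⟨_, rfl⟩, hg _⟩⟩

/-- **Finiteness of `Iso(Δ, M)`**: for `0 < m < n`, an `m`-space group `M` and an
`(n-m)`-space group `Δ`, there are only finitely many isomorphism classes of pairs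
`(Γ, N)` with `Γ` an `n`-space group and `N` a complete normal subgroup of `Γ` such that
`N ≅ M` and `Γ/N ≅ Δ`. -/
theorem iso_delta_M_finite {n m : ℕ} (hm : 0 < m) (hmn : m < n)
    (M : Subgroup (EuclideanSpace ℝ (Fin m) ≃ᵢ EuclideanSpace ℝ (Fin m)))
    (hM : IsSpaceGroup M)
    (Δ : Subgroup (EuclideanSpace ℝ (Fin (n - m)) ≃ᵢ EuclideanSpace ℝ (Fin (n - m))))
    (hΔ : IsSpaceGroup Δ) :
    ∃ S : Set (Subgroup (EuclideanSpace ℝ (Fin n) ≃ᵢ EuclideanSpace ℝ (Fin n)) ×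
        Subgroup (EuclideanSpace ℝ (Fin n) ≃ᵢ EuclideanSpace ℝ (Fin n))),
      S.Finite ∧
      (∀ p ∈ S, IsoClassCondition M Δ p.1 p.2) ∧
      ∀ Γ N : Subgroup (EuclideanSpace ℝ (Fin n) ≃ᵢ EuclideanSpace ℝ (Fin n)),
        IsoClassCondition M Δ Γ N →
        ∃ p ∈ S, ∃ ζ : Γ ≃* ↥p.1,
          ∀ x : Γ, (x : EuclideanSpace ℝ (Fin n) ≃ᵢ EuclideanSpace ℝ (Fin n)) ∈ N ↔
            ((ζ x : ↥p.1) : EuclideanSpace ℝ (Fin n) ≃ᵢ EuclideanSpace ℝ (Fin n)) ∈ p.2 := by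
  obtain ⟨K, hK, h⟩ := exists_isFrame (EuclideanSpace ℝ (Fin n)) (ι := Fin n)
    (finCongr finrank_euclideanSpace_fin)
  choose p b I hF using fun q : {q : Subgroup (EuclideanSpace ℝ (Fin n) ≃ᵢ
      EuclideanSpace ℝ (Fin n)) × Subgroup (EuclideanSpace ℝ (Fin n) ≃ᵢ
      EuclideanSpace ℝ (Fin n)) // IsoClassCondition M Δ q.1 q.2} => h q.1.1 q.1.2 q.2.1 q.2.2.1
  have hfin : (Set.range fun q => (coordSet q.1.1 K (p q) (b q), I q)).Finite := by
    refine ((finite_bounded_coords K).finite_subsets.prod Set.finite_univ).subset ?_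
    rintro _ ⟨q, rfl⟩
    exact ⟨fun x hx => hx.1, Set.mem_univ _⟩
  obtain ⟨S, hS, hSiso⟩ := exists_finite_representatives hfin
  refine ⟨Subtype.val '' S, hS.image _, ?_, fun Γ N hΓN => ?_⟩
  · rintro _ ⟨q, -, rfl⟩
    exact q.2
  · obtain ⟨q, hq, hqf⟩ := hSiso ⟨(Γ, N), hΓN⟩
    rw [Prod.mk.injEq] at hqf
    have hFq := hF q
    rw [hqf.2] at hFq
    exact ⟨q, ⟨q, hq, rfl⟩, (hF ⟨(Γ, N), hΓN⟩).exists_mulEquiv hK hΓN.2.1 q.2.2.1 hFq hqf.1.symm⟩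
end
end
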